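/- arXiv:2007.11169 — 2 statements merged into one kernel-verified Lean document; each statement's English description precedes it below -/
import Mathlib

section
/- Let f, T ∈ F_q[x] be monic divisors of x^n − 1 with deg f = k and gcd((x^n − 1)/f, T) ≠ 1, and let m be a positive divisor of q^n − 1. Let Q_1, …, Q_s be monic irreducible polynomials in F_q[x] and p_1, …, p_r be prime numbers such that rad(x^n − 1) = rad(T) · Q_1 ⋯ Q_s and rad(q^n − 1) = rad(m) · p_1 ⋯ p_r. Suppose δ := 1 − Σ_{i=1}^r 1/p_i − Σ_{j=1}^s 1/q^{deg Q_j} > 0 and set Δ := (r + s − 1)/δ + 2. If q^{n/2 − k} ≥ W(m) · W(T) · Δ, then N_f(x^n − 1, q^n − 1) > 0. -/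
open Polynomial

noncomputable section

/-- The linearized `q`-associate of `f = Σ a_i x^i ∈ F_q[x]`, evaluated at `α ∈ F_{q^n}`:
`L_f(α) = Σ a_i α^{q^i}`. -/
def Lf {F E : Type*} [Field F] [Field E] [Algebra F E] (q : ℕ) (f : Polynomial F) (α : E) : E :=
  ∑ i ∈ Finset.range (f.natDegree + 1), algebraMap F E (f.coeff i) * α ^ q ^ i

/-- For `m ∣ q^n - 1`, an element `α ∈ F_{q^n}*` is `m`-free if whenever `α = β^d` for some
`β ∈ F_{q^n}` and some divisor `d` of `m`, then `d = 1`. -/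
def IsFree {E : Type*} [Field E] (m : ℕ) (α : E) : Prop :=
  α ≠ 0 ∧ ∀ d : ℕ, d ∣ m → (∃ β : E, α = β ^ d) → d = 1

/-- For a monic divisor `T` of `x^n - 1` in `F_q[x]`, an element `α ∈ F_{q^n}` is `T`-free
if whenever `α = L_h(β)` for some `β ∈ F_{q^n}` and some monic divisor `h` of `T`,
then `h = 1`. -/
def IsPolyFree {F E : Type*} [Field F] [Field E] [Algebra F E] (q : ℕ) (T : Polynomial F)
    (α : E) : Prop :=
  ∀ h : Polynomial F, h.Monic → h ∣ T → (∃ β : E, Lf q h β = α) → h = 1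

/-- `Nf q F E f T m` is the number of `T`-free elements `α ∈ F_{q^n}` such that `L_f(α)` is
`m`-free. -/
def Nf (q : ℕ) (F E : Type*) [Field F] [Field E] [Algebra F E]
    (f T : Polynomial F) (m : ℕ) : ℕ :=
  Nat.card {α : E // IsPolyFree q T α ∧ IsFree m (Lf q f α)}

/-- `Wnat m` is the number of squarefree divisors of the integer `m`. -/
def Wnat (m : ℕ) : ℕ := Nat.card {d : ℕ // d ∣ m ∧ Squarefree d}

/-- `Wpoly T` is the number of squarefree monic divisors of the polynomial `T`. -/
def Wpoly {F : Type*} [Field F] (T : Polynomial F) : ℕ :=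
  Nat.card {h : Polynomial F // h.Monic ∧ Squarefree h ∧ h ∣ T}

/-- `radNat m` is the largest squarefree divisor of the positive integer `m`. -/
def radNat (m : ℕ) : ℕ := ∏ p ∈ m.primeFactors, p

/-- `radPoly T` is the monic squarefree radical of the polynomial `T` : the product of its
distinct monic irreducible factors. -/
def radPoly {F : Type*} [Field F] (T : Polynomial F) : Polynomial F :=
  letI := Classical.decEq F
  ∏ p ∈ (UniqueFactorizationMonoid.normalizedFactors T).toFinset, p

/-- The average of the nontrivial characters of `A` that are trivial on the subgroup `V`,
in closed form. -/
def balanced {A : Type*} [AddCommGroup A] (V : AddSubgroup A) (a : A) : ℂ :=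
  letI := Classical.dec (a ∈ V)
  ((V.index : ℂ) * (if a ∈ V then 1 else 0) - 1) / ((V.index : ℂ) - 1)

/-- The indicator function of the complement of `V`. -/
def coindicator {A : Type*} [AddCommGroup A] (V : AddSubgroup A) (a : A) : ℂ :=
  letI := Classical.dec (a ∈ V)
  if a ∈ V then 0 else 1

lemma index_sub_one_ne_zero {A : Type*} [AddCommGroup A] {V : AddSubgroup A}
    (hV : 1 < V.index) : (V.index : ℂ) - 1 ≠ 0 := by
  rw [sub_ne_zero]
  exact_mod_cast hV.ne'

lemma coindicator_eq {A : Type*} [AddCommGroup A] {V : AddSubgroup A} (hV : 1 < V.index) (a : A) :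
    coindicator V a = (1 - 1 / (V.index : ℂ)) * (1 - balanced V a) := by
  have h1 := index_sub_one_ne_zero hV
  have h0 : (V.index : ℂ) ≠ 0 := by exact_mod_cast (by omega : V.index ≠ 0)
  unfold coindicator balanced
  by_cases h : a ∈ V
  · simp only [h, if_true]
    field_simp
    ring
  · simp only [h, if_false]
    field_simp
    ring

lemma sum_characters_quotient {A : Type*} [AddCommGroup A] [Finite A] (V : AddSubgroup A) (a : A)
    [Decidable (a ∈ V)] :
    ∑ ψ : AddChar (A ⧸ V) ℂ, ψ (QuotientAddGroup.mk' V a) =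
      (V.index : ℂ) * (if a ∈ V then 1 else 0) := by
  classical
  have := Fintype.ofFinite (A ⧸ V)
  rw [AddChar.sum_apply_eq_ite]
  have hc : Fintype.card (A ⧸ V) = V.index := by
    rw [← Nat.card_eq_fintype_card]; rfl
  simp only [QuotientAddGroup.mk'_apply, QuotientAddGroup.eq_zero_iff, hc]
  split_ifs <;> simp

lemma card_characters_quotient {A : Type*} [AddCommGroup A] [Finite A] (V : AddSubgroup A) :
    Fintype.card (AddChar (A ⧸ V) ℂ) = V.index := by
  have := Fintype.ofFinite (A ⧸ V)
  rw [AddChar.card_eq, ← Nat.card_eq_fintype_card]; rfl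

/-- A bound valid for all nontrivial characters trivial on `V` is inherited by their average. -/
lemma norm_sum_balanced_le {A X : Type*} [AddCommGroup A] [Finite A] [Fintype X]
    {V : AddSubgroup A} (hV : 1 < V.index) (π : X → A) (b : X → ℂ) (K : ℝ)
    (h : ∀ χ : AddChar A ℂ, χ ≠ 0 → (∀ v ∈ V, χ v = 1) → ‖∑ x, χ (π x) * b x‖ ≤ K) :
    ‖∑ x, balanced V (π x) * b x‖ ≤ K := by
  classical
  have h1 := index_sub_one_ne_zero hV
  have hbal : ∀ a, balanced V a * ((V.index : ℂ) - 1) =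
      ∑ ψ ∈ Finset.univ.erase (0 : AddChar (A ⧸ V) ℂ), ψ (QuotientAddGroup.mk' V a) := by
    intro a
    rw [Finset.sum_erase_eq_sub (Finset.mem_univ _), sum_characters_quotient, AddChar.zero_apply]
    unfold balanced
    rw [div_mul_cancel₀ _ h1]
  have hsum : (∑ x, balanced V (π x) * b x) * ((V.index : ℂ) - 1) =
      ∑ ψ ∈ Finset.univ.erase (0 : AddChar (A ⧸ V) ℂ),
        ∑ x, (ψ.compAddMonoidHom (QuotientAddGroup.mk' V)) (π x) * b x := by
    rw [Finset.sum_mul, Finset.sum_comm]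
    refine Finset.sum_congr rfl fun x _ => ?_
    rw [mul_right_comm, hbal, Finset.sum_mul]
    rfl
  have hpos : (0 : ℝ) < (V.index : ℝ) - 1 := by
    have : (1 : ℝ) < V.index := by exact_mod_cast hV
    linarith
  have hnorm : ‖(V.index : ℂ) - 1‖ = (V.index : ℝ) - 1 := by
    rw [← abs_of_pos hpos, ← Real.norm_eq_abs, ← Complex.norm_real]
    push_cast
    rfl
  have hle : ‖(∑ x, balanced V (π x) * b x) * ((V.index : ℂ) - 1)‖ ≤ ((V.index : ℝ) - 1) * K := by
    rw [hsum]
    refine (norm_sum_le_of_le _ (f := fun ψ : AddChar (A ⧸ V) ℂ =>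
      ∑ x, (ψ.compAddMonoidHom (QuotientAddGroup.mk' V)) (π x) * b x)
      (n := fun _ => K) ?_).trans ?_
    · intro ψ hψ
      refine h _ ?_ ?_
      · intro h0
        refine (Finset.mem_erase.mp hψ).1 ?_
        ext a
        obtain ⟨a, rfl⟩ := QuotientAddGroup.mk'_surjective V a
        exact DFunLike.congr_fun h0 a
      · intro v hv
        have : QuotientAddGroup.mk' V v = 0 := by simpa using hv
        rw [AddChar.compAddMonoidHom_apply, this, AddChar.map_zero_eq_one]
    · rw [Finset.sum_const, Finset.card_erase_of_mem (Finset.mem_univ _), Finset.card_univ,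
        card_characters_quotient, nsmul_eq_mul, Nat.cast_sub hV.le, Nat.cast_one]
  rw [norm_mul, hnorm, mul_comm] at hle
  exact le_of_mul_le_mul_left hle hpos

/-- A nontrivial character trivial on `V` is orthogonal to every function invariant under a
subgroup supplementing `V`. -/
lemma sum_character_mul_eq_zero {A : Type*} [AddCommGroup A] [Fintype A] {V H : AddSubgroup A}
    (hHV : H ⊔ V = ⊤) {u : A → ℂ} (hu : ∀ a, ∀ h ∈ H, u (a + h) = u a) {χ : AddChar A ℂ}
    (hχ : χ ≠ 0) (hχV : ∀ v ∈ V, χ v = 1) : ∑ a, χ a * u a = 0 := by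
  obtain ⟨h, hH, hh⟩ : ∃ h ∈ H, χ h ≠ 1 := by
    by_contra! hcon
    refine hχ ?_
    ext a
    have ha : a ∈ H ⊔ V := hHV ▸ AddSubgroup.mem_top a
    obtain ⟨x, hx, y, hy, rfl⟩ := AddSubgroup.mem_sup.mp ha
    rw [AddChar.map_add_eq_mul, hcon x hx, hχV y hy, AddChar.zero_apply, one_mul]
  have key : χ h * ∑ a, χ a * u a = ∑ a, χ a * u a := by
    rw [Finset.mul_sum]
    refine Fintype.sum_equiv (Equiv.addRight h) _ _ fun a => ?_
    rw [Equiv.coe_addRight, hu a h hH, AddChar.map_add_eq_mul]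
    ring
  have : (χ h - 1) * ∑ a, χ a * u a = 0 := by rw [sub_mul, one_mul, key, sub_self]
  exact (mul_eq_zero.mp this).resolve_left (sub_ne_zero.mpr hh)

lemma balanced_add {A : Type*} [AddCommGroup A] {V : AddSubgroup A} {v : A} (hv : v ∈ V) (a : A) :
    balanced V (a + v) = balanced V a := by
  have h := V.add_mem_cancel_right hv (y := a)
  unfold balanced
  by_cases ha : a ∈ V <;> simp [h, ha]

section Sieve

variable {ι A X : Type*} [AddCommGroup A]

/-- The normalized sieving weight of the subgroups `V i`, `i ∈ S`. -/
def sieveWeight (V : ι → AddSubgroup A) (S : Finset ι) (a : A) : ℂ :=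
  ∏ i ∈ S, (1 - balanced (V i) a)

/-- The expected density of the complement of `⋃ i ∈ S, V i`. -/
def sieveDensity (V : ι → AddSubgroup A) (S : Finset ι) : ℝ :=
  ∏ i ∈ S, (1 - 1 / ((V i).index : ℝ))

lemma sieveDensity_pos {V : ι → AddSubgroup A} {S : Finset ι} (hV : ∀ i ∈ S, 1 < (V i).index) :
    0 < sieveDensity V S := by
  refine Finset.prod_pos fun i hi => ?_
  have h1 : (1 : ℝ) < (V i).index := by exact_mod_cast hV i hi
  rw [sub_pos, div_lt_one (by linarith)]
  exact h1

lemma prod_coindicator {V : ι → AddSubgroup A} {S : Finset ι} (hV : ∀ i ∈ S, 1 < (V i).index)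
    (a : A) : ∏ i ∈ S, coindicator (V i) a = (sieveDensity V S : ℂ) * sieveWeight V S a := by
  unfold sieveDensity sieveWeight
  push_cast
  rw [← Finset.prod_mul_distrib]
  exact Finset.prod_congr rfl fun i hi => coindicator_eq (hV i hi) a

lemma sieveWeight_add {V : ι → AddSubgroup A} {S : Finset ι} {h : A} (hh : h ∈ ⨅ i ∈ S, V i)
    (a : A) : sieveWeight V S (a + h) = sieveWeight V S a := by
  refine Finset.prod_congr rfl fun i hi => ?_
  rw [balanced_add]
  simp only [AddSubgroup.mem_iInf] at hh
  exact hh i hi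

lemma sum_balanced_mul_sieveWeight [Fintype A] {V : ι → AddSubgroup A} {S : Finset ι} {j : ι}
    (hj : 1 < (V j).index) (hind : (⨅ i ∈ S, V i) ⊔ V j = ⊤) :
    ∑ a, balanced (V j) a * sieveWeight V S a = 0 := by
  rw [← norm_le_zero_iff]
  refine norm_sum_balanced_le hj id _ 0 fun χ hχ hχV => ?_
  rw [norm_le_zero_iff]
  exact sum_character_mul_eq_zero hind (fun a h hh => sieveWeight_add hh a) hχ hχV

lemma sum_sieveWeight [Fintype A] {V : ι → AddSubgroup A} {S : Finset ι}
    (hV : ∀ i ∈ S, 1 < (V i).index)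
    (hind : ∀ S' ⊆ S, ∀ j ∈ S, j ∉ S' → (⨅ i ∈ S', V i) ⊔ V j = ⊤) :
    ∑ a, sieveWeight V S a = Fintype.card A := by
  classical
  induction S using Finset.induction_on with
  | empty => simp [sieveWeight]
  | insert j S hj ih =>
    have hjS := Finset.mem_insert_self j S
    have hsub := Finset.subset_insert j S
    have h0 := sum_balanced_mul_sieveWeight (hV j hjS) (hind S hsub j hjS hj)
    rw [← ih (fun i hi => hV i (hsub hi))
      (fun S' hS' i hi => hind S' (hS'.trans hsub) i (hsub hi)), ← sub_zero (∑ a, sieveWeight V S a),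
      ← h0, ← Finset.sum_sub_distrib]
    refine Finset.sum_congr rfl fun a _ => ?_
    rw [sieveWeight, Finset.prod_insert hj, sub_mul, one_mul]
    rfl

/-- Multiplying by a sieving weight in `S` costs at most a factor `2 ^ #S` in a bound that is
uniform over all characters. -/
lemma norm_sum_sieveWeight_le [Finite A] [Fintype X] {V : ι → AddSubgroup A} {S : Finset ι}
    (hV : ∀ i ∈ S, 1 < (V i).index) (π : X → A) (b : X → ℂ) (K : ℝ)
    (h : ∀ χ : AddChar A ℂ, ‖∑ x, χ (π x) * b x‖ ≤ K) (χ : AddChar A ℂ) :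
    ‖∑ x, χ (π x) * (sieveWeight V S (π x) * b x)‖ ≤ 2 ^ S.card * K := by
  classical
  induction S using Finset.induction_on generalizing χ with
  | empty => simpa [sieveWeight] using h χ
  | insert j S hj ih =>
    have hsub := Finset.subset_insert j S
    have ih' := ih fun i hi => hV i (hsub hi)
    have hb := norm_sum_balanced_le (hV j (Finset.mem_insert_self j S)) π
      (fun x => χ (π x) * (sieveWeight V S (π x) * b x)) (2 ^ S.card * K) fun ψ _ _ => by
        simpa only [AddChar.add_apply, mul_assoc] using ih' (ψ + χ)
    rw [Finset.card_insert_of_notMem hj, pow_succ]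
    have : ∑ x, χ (π x) * (sieveWeight V (insert j S) (π x) * b x) =
        ∑ x, χ (π x) * (sieveWeight V S (π x) * b x) -
        ∑ x, balanced (V j) (π x) * (χ (π x) * (sieveWeight V S (π x) * b x)) := by
      rw [← Finset.sum_sub_distrib]
      refine Finset.sum_congr rfl fun x _ => ?_
      rw [sieveWeight, Finset.prod_insert hj, ← sieveWeight]
      ring
    rw [this]
    refine (norm_sub_le _ _).trans ?_
    linarith [ih' χ]

lemma norm_sum_balanced_sieveWeight_le [Finite A] [Fintype X] {V : ι → AddSubgroup A}
    {S : Finset ι} (hV : ∀ i ∈ S, 1 < (V i).index) {j : ι} (hj : 1 < (V j).index) (π : X → A)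
    (b : X → ℂ) (K : ℝ) (h : ∀ χ : AddChar A ℂ, ‖∑ x, χ (π x) * b x‖ ≤ K) :
    ‖∑ x, balanced (V j) (π x) * (sieveWeight V S (π x) * b x)‖ ≤ 2 ^ S.card * K :=
  norm_sum_balanced_le hj π _ _ fun χ _ _ => norm_sum_sieveWeight_le hV π b K h χ

end Sieve

section MixedSieve

variable {ι A G X : Type*} [AddCommGroup A] [AddCommGroup G] [Fintype X]

/-- The subgroup of multiples of `p` in `G`. -/
def multiples (G : Type*) [AddCommGroup G] (p : ℕ) : AddSubgroup G :=
  (nsmulAddMonoidHom p : G →+ G).range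

lemma nsmul_eq_zero_of_trivial_on_multiples {p : ℕ} {χ : AddChar G ℂ}
    (h : ∀ v ∈ multiples G p, χ v = 1) : p • χ = 0 := by
  ext a
  rw [AddChar.nsmul_apply, AddChar.zero_apply, ← AddChar.map_nsmul_eq_pow]
  exact h _ ⟨a, rfl⟩

lemma eq_zero_of_coprime_nsmul {M : Type*} [AddCommGroup M] {a : M} {m n : ℕ} (h : m.Coprime n)
    (hm : m • a = 0) (hn : n • a = 0) : a = 0 := by
  have := Nat.dvd_gcd (addOrderOf_dvd_of_nsmul_eq_zero hm) (addOrderOf_dvd_of_nsmul_eq_zero hn)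
  rw [h.gcd_eq_one, Nat.dvd_one] at this
  exact AddMonoid.addOrderOf_eq_one_iff.mp this

variable [Finite G] {π₁ : X → A} {π₂ : X → G} {C : ℝ} {S : Finset ℕ}

lemma norm_sum_character_multiplesWeight_le
    (hC : ∀ (χ : AddChar A ℂ) (η : AddChar G ℂ), η ≠ 0 → ‖∑ x, χ (π₁ x) * η (π₂ x)‖ ≤ C)
    (hS : ∀ p ∈ S, p.Prime ∧ 1 < (multiples G p).index) (χ : AddChar A ℂ) {η : AddChar G ℂ}
    (hη : η ≠ 0) {e : ℕ} (he : e • η = 0) (hcop : ∀ p ∈ S, e.Coprime p) :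
    ‖∑ x, χ (π₁ x) * (η (π₂ x) * sieveWeight (multiples G) S (π₂ x))‖ ≤ 2 ^ S.card * C := by
  induction S using Finset.induction_on generalizing η e with
  | empty => simpa [sieveWeight] using hC χ η hη
  | insert p S hp ih =>
    have hsub := Finset.subset_insert p S
    have hpS := Finset.mem_insert_self p S
    have ih' := @ih fun i hi => hS i (hsub hi)
    have hb := norm_sum_balanced_le (hS p hpS).2 π₂
      (fun x => χ (π₁ x) * (η (π₂ x) * sieveWeight (multiples G) S (π₂ x))) (2 ^ S.card * C)
      fun ψ hψ hψp => by
        have hpψ := nsmul_eq_zero_of_trivial_on_multiples hψp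
        have hne : ψ + η ≠ 0 := by
          intro h0
          have hψη : ψ = -η := eq_neg_of_add_eq_zero_left h0
          refine hψ (eq_zero_of_coprime_nsmul (hcop p hpS) ?_ hpψ)
          rw [hψη, smul_neg, he, neg_zero]
        have hmul : (e * p) • (ψ + η) = 0 := by
          rw [smul_add, mul_smul, hpψ, mul_comm, mul_smul, he, nsmul_zero, nsmul_zero,
            add_zero]
        have := ih' hne hmul fun l hl => Nat.Coprime.mul_left (hcop l (hsub hl)) <|
          (Nat.coprime_primes (hS p hpS).1 (hS l (hsub hl)).1).mpr fun h => hp (h ▸ hl)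
        refine le_of_eq_of_le ?_ this
        congr 1
        refine Finset.sum_congr rfl fun x _ => ?_
        rw [AddChar.add_apply]
        ring
    rw [Finset.card_insert_of_notMem hp, pow_succ]
    have : ∑ x, χ (π₁ x) * (η (π₂ x) * sieveWeight (multiples G) (insert p S) (π₂ x)) =
        ∑ x, χ (π₁ x) * (η (π₂ x) * sieveWeight (multiples G) S (π₂ x)) -
        ∑ x, balanced (multiples G p) (π₂ x) *
          (χ (π₁ x) * (η (π₂ x) * sieveWeight (multiples G) S (π₂ x))) := by
      rw [← Finset.sum_sub_distrib]
      refine Finset.sum_congr rfl fun x _ => ?_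
      rw [sieveWeight, Finset.prod_insert hp, ← sieveWeight]
      ring
    rw [this]
    refine (norm_sub_le _ _).trans ?_
    linarith [ih' hη he fun l hl => hcop l (hsub hl)]

lemma norm_sum_balanced_multiplesWeight_le
    (hC : ∀ (χ : AddChar A ℂ) (η : AddChar G ℂ), η ≠ 0 → ‖∑ x, χ (π₁ x) * η (π₂ x)‖ ≤ C)
    (hS : ∀ p ∈ S, p.Prime ∧ 1 < (multiples G p).index) (χ : AddChar A ℂ) {p : ℕ}
    (hp : p.Prime) (hpi : 1 < (multiples G p).index) (hpS : p ∉ S) :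
    ‖∑ x, χ (π₁ x) * (balanced (multiples G p) (π₂ x) * sieveWeight (multiples G) S (π₂ x))‖ ≤
      2 ^ S.card * C := by
  have := norm_sum_balanced_le hpi π₂
    (fun x => χ (π₁ x) * sieveWeight (multiples G) S (π₂ x)) (2 ^ S.card * C) fun ψ hψ hψp => by
      have := norm_sum_character_multiplesWeight_le hC hS χ hψ
        (nsmul_eq_zero_of_trivial_on_multiples hψp)
        fun l hl => (Nat.coprime_primes hp (hS l hl).1).mpr fun h => hpS (h ▸ hl)
      simpa only [mul_left_comm] using this
  simpa only [mul_left_comm] using this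

lemma norm_sum_multiplesWeight_sub_one_le
    (hC : ∀ (χ : AddChar A ℂ) (η : AddChar G ℂ), η ≠ 0 → ‖∑ x, χ (π₁ x) * η (π₂ x)‖ ≤ C)
    (hS : ∀ p ∈ S, p.Prime ∧ 1 < (multiples G p).index) (χ : AddChar A ℂ) :
    ‖∑ x, χ (π₁ x) * (sieveWeight (multiples G) S (π₂ x) - 1)‖ ≤ (2 ^ S.card - 1) * C := by
  induction S using Finset.induction_on with
  | empty => simp [sieveWeight]
  | insert p S hp ih =>
    have hsub := Finset.subset_insert p S
    have hpS := hS p (Finset.mem_insert_self p S)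
    have hS' := fun i hi => hS i (hsub hi)
    have hb := norm_sum_balanced_multiplesWeight_le hC hS' χ hpS.1 hpS.2 hp
    rw [Finset.card_insert_of_notMem hp, pow_succ]
    have : ∑ x, χ (π₁ x) * (sieveWeight (multiples G) (insert p S) (π₂ x) - 1) =
        ∑ x, χ (π₁ x) * (sieveWeight (multiples G) S (π₂ x) - 1) -
        ∑ x, χ (π₁ x) *
          (balanced (multiples G p) (π₂ x) * sieveWeight (multiples G) S (π₂ x)) := by
      rw [← Finset.sum_sub_distrib]
      refine Finset.sum_congr rfl fun x _ => ?_
      rw [sieveWeight, Finset.prod_insert hp, ← sieveWeight]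
      ring
    rw [this]
    refine (norm_sub_le _ _).trans ?_
    linarith [ih hS']

/-- If the weight `ρ * w` is the indicator of `Z`, then about a proportion `1 / V.index` of `Z`
lies above `V`. -/
lemma card_filter_mem_le {V : AddSubgroup A} [DecidablePred (· ∈ V)] (hV : 1 < V.index)
    (π : X → A) {Z : Finset X} {w : X → ℂ} {ρ D : ℝ} (hρ : 0 ≤ ρ)
    (hZ : ∀ x, (x ∈ Z → (ρ : ℂ) * w x = 1) ∧ (x ∉ Z → (ρ : ℂ) * w x = 0))
    (hD : ‖∑ x, balanced V (π x) * w x‖ ≤ D) :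
    ((Z.filter fun x => π x ∈ V).card : ℝ) ≤
      Z.card * (1 / V.index) + (1 - 1 / V.index) * (ρ * D) := by
  classical
  have hN : (1 : ℝ) < V.index := by exact_mod_cast hV
  have hcardZ : (Z.card : ℂ) = ∑ x, (ρ : ℂ) * w x := by
    rw [Finset.card_eq_sum_ones, Nat.cast_sum, ← Finset.sum_subset (Finset.subset_univ Z)
      fun x _ hx => (hZ x).2 hx]
    exact Finset.sum_congr rfl fun x hx => by rw [(hZ x).1 hx, Nat.cast_one]
  have hcardF : ((Z.filter fun x => π x ∈ V).card : ℂ) =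
      ∑ x, (1 - coindicator V (π x)) * ((ρ : ℂ) * w x) := by
    rw [Finset.card_eq_sum_ones, Nat.cast_sum, ← Finset.sum_subset (Finset.subset_univ
      (Z.filter fun x => π x ∈ V)) (fun x _ hx => ?_)]
    · refine Finset.sum_congr rfl fun x hx => ?_
      obtain ⟨h1, h2⟩ := Finset.mem_filter.mp hx
      simp [coindicator, h2, (hZ x).1 h1]
    · by_cases h1 : x ∈ Z
      · have h2 : π x ∉ V := fun h2 => hx (Finset.mem_filter.mpr ⟨h1, h2⟩)
        simp [coindicator, h2]
      · rw [(hZ x).2 h1, mul_zero]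
  have hdiff : ((Z.filter fun x => π x ∈ V).card : ℂ) - Z.card * (1 / V.index) =
      ((1 - 1 / V.index : ℝ) : ℂ) * (ρ * ∑ x, balanced V (π x) * w x) := by
    rw [hcardF, hcardZ, Finset.sum_mul, ← Finset.sum_sub_distrib, Finset.mul_sum, Finset.mul_sum]
    refine Finset.sum_congr rfl fun x _ => ?_
    rw [coindicator_eq hV]
    push_cast
    ring
  have hnn : (0 : ℝ) ≤ 1 - 1 / V.index := by
    rw [sub_nonneg, div_le_one (by linarith)]
    exact hN.le
  have hnorm : ‖((((Z.filter fun x => π x ∈ V).card : ℝ) - Z.card * (1 / V.index) : ℝ) : ℂ)‖ ≤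
      (1 - 1 / V.index) * (ρ * D) := by
    push_cast
    rw [hdiff, norm_mul, norm_mul, Complex.norm_of_nonneg hnn, Complex.norm_of_nonneg hρ]
    gcongr
  rw [Complex.norm_real, Real.norm_eq_abs] at hnorm
  linarith [le_abs_self (((Z.filter fun x => π x ∈ V).card : ℝ) - Z.card * (1 / V.index))]

/-- A lower bound sieve for the subgroups `V i` of `A` and the subgroups of multiples of primes
in `G`, given uniform bounds for mixed character sums. -/
theorem exists_unsieved_of_sieve_bound [Fintype A] {V : ι → AddSubgroup A} {T : Finset ι}
    (hπ : Function.Injective π₁) (hrange : ∀ a, (∀ i ∈ T, a ∉ V i) → a ∈ Set.range π₁)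
    (hCpos : 0 < C)
    (hC : ∀ (χ : AddChar A ℂ) (η : AddChar G ℂ), η ≠ 0 → ‖∑ x, χ (π₁ x) * η (π₂ x)‖ ≤ C)
    (hS : ∀ p ∈ S, p.Prime ∧ 1 < (multiples G p).index) (hT : ∀ i ∈ T, 1 < (V i).index)
    (hind : ∀ T' ⊆ T, ∀ j ∈ T, j ∉ T' → (⨅ i ∈ T', V i) ⊔ V j = ⊤)
    {r s : ℕ} {p : Fin r → ℕ} (hp : ∀ i, (p i).Prime ∧ 1 < (multiples G (p i)).index)
    {Q : Fin s → ι} (hQ : ∀ j, 1 < (V (Q j)).index)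
    (hindQ : ∀ j, Q j ∉ T → (⨅ i ∈ T, V i) ⊔ V (Q j) = ⊤) {δ : ℝ}
    (hδdef : δ = 1 - (∑ i, (1 : ℝ) / (multiples G (p i)).index) -
      ∑ j, (1 : ℝ) / (V (Q j)).index) (hδ : 0 < δ)
    (hbound : 2 ^ S.card * 2 ^ T.card * (((r : ℝ) + s - 1) / δ + 2) * C ≤ Fintype.card A) :
    ∃ x, (∀ i ∈ T, π₁ x ∉ V i) ∧ (∀ j, π₁ x ∉ V (Q j)) ∧ (∀ l ∈ S, π₂ x ∉ multiples G l) ∧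
      ∀ i, π₂ x ∉ multiples G (p i) := by
  classical
  by_contra! hcon
  set ρ : ℝ := sieveDensity V T * sieveDensity (multiples G) S with hρdef
  have hρ : 0 < ρ := mul_pos (sieveDensity_pos hT) (sieveDensity_pos fun l hl => (hS l hl).2)
  set w : X → ℂ := fun x => sieveWeight V T (π₁ x) * sieveWeight (multiples G) S (π₂ x) with hw
  set Z : Finset X := Finset.univ.filter fun x =>
    (∀ i ∈ T, π₁ x ∉ V i) ∧ ∀ l ∈ S, π₂ x ∉ multiples G l with hZdef
  set D : ℝ := 2 ^ T.card * (2 ^ S.card * C) with hDdef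
  have hρw : ∀ x, (ρ : ℂ) * w x =
      (∏ i ∈ T, coindicator (V i) (π₁ x)) * ∏ l ∈ S, coindicator (multiples G l) (π₂ x) := by
    intro x
    rw [prod_coindicator hT, prod_coindicator fun l hl => (hS l hl).2, hρdef, hw]
    push_cast
    ring
  have hZ : ∀ x, (x ∈ Z → (ρ : ℂ) * w x = 1) ∧ (x ∉ Z → (ρ : ℂ) * w x = 0) := by
    intro x
    rw [hρw]
    refine ⟨fun hx => ?_, fun hx => ?_⟩
    · obtain ⟨h1, h2⟩ := (Finset.mem_filter.mp hx).2
      rw [Finset.prod_eq_one fun i hi => by simp [coindicator, h1 i hi],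
        Finset.prod_eq_one fun i hi => by simp [coindicator, h2 i hi], one_mul]
    · by_cases h1 : ∀ i ∈ T, π₁ x ∉ V i
      · have h2 : ¬ ∀ l ∈ S, π₂ x ∉ multiples G l := fun h2 =>
          hx (Finset.mem_filter.mpr ⟨Finset.mem_univ _, h1, h2⟩)
        push Not at h2
        obtain ⟨l, hl, hxl⟩ := h2
        rw [Finset.prod_eq_zero (i := l) (s := S) hl (by simp [coindicator, hxl]), mul_zero]
      · push Not at h1
        obtain ⟨i, hi, hxi⟩ := h1
        rw [Finset.prod_eq_zero (i := i) (s := T) hi (by simp [coindicator, hxi]), zero_mul]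
  have hvanish : ∀ a, a ∉ Set.range π₁ → sieveWeight V T a = 0 := by
    intro a ha
    obtain ⟨i, hi, hai⟩ : ∃ i ∈ T, a ∈ V i := by
      by_contra! h
      exact ha (hrange a h)
    have h0 := prod_coindicator hT a
    rw [Finset.prod_eq_zero hi (by simp [coindicator, hai])] at h0
    refine (mul_eq_zero.mp h0.symm).resolve_left ?_
    exact_mod_cast (sieveDensity_pos hT).ne'
  have hsumX : ∀ g : A → ℂ, ∑ x, g (π₁ x) * sieveWeight V T (π₁ x) =
      ∑ a, g a * sieveWeight V T a := by
    intro g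
    refine Fintype.sum_of_injective π₁ hπ _ _ ?_ fun _ => rfl
    intro a ha
    rw [hvanish a ha, mul_zero]
  have hnonneg : ∀ N : ℕ, 1 < N → 0 ≤ Z.card * (1 / (N : ℝ)) + (1 - 1 / (N : ℝ)) * (ρ * D) := by
    intro N hN
    have h1 : (1 : ℝ) < N := by exact_mod_cast hN
    have h2 : (0 : ℝ) ≤ 1 - 1 / N := by
      rw [sub_nonneg, div_le_one (by linarith)]
      exact h1.le
    positivity
  have hFp : ∀ i, ((Z.filter fun x => π₂ x ∈ multiples G (p i)).card : ℝ) ≤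
      Z.card * (1 / (multiples G (p i)).index) + (1 - 1 / (multiples G (p i)).index) * (ρ * D) := by
    intro i
    by_cases hi : p i ∈ S
    · have : Z.filter (fun x => π₂ x ∈ multiples G (p i)) = ∅ :=
        Finset.filter_eq_empty_iff.mpr fun x hx => (Finset.mem_filter.mp hx).2.2 _ hi
      rw [this, Finset.card_empty, Nat.cast_zero]
      exact hnonneg _ (hp i).2
    · refine card_filter_mem_le (hp i).2 π₂ hρ.le hZ ?_
      have := norm_sum_sieveWeight_le hT π₁ _ _
        (fun χ => norm_sum_balanced_multiplesWeight_le hC hS χ (hp i).1 (hp i).2 hi) 0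
      simpa only [AddChar.zero_apply, one_mul, hw, mul_left_comm] using this
  have hFQ : ∀ j, ((Z.filter fun x => π₁ x ∈ V (Q j)).card : ℝ) ≤
      Z.card * (1 / (V (Q j)).index) + (1 - 1 / (V (Q j)).index) * (ρ * D) := by
    intro j
    by_cases hj : Q j ∈ T
    · have : Z.filter (fun x => π₁ x ∈ V (Q j)) = ∅ :=
        Finset.filter_eq_empty_iff.mpr fun x hx => (Finset.mem_filter.mp hx).2.1 _ hj
      rw [this, Finset.card_empty, Nat.cast_zero]
      exact hnonneg _ (hQ j)
    · refine card_filter_mem_le (hQ j) π₁ hρ.le hZ ?_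
      have h0 : ∑ x, balanced (V (Q j)) (π₁ x) * w x = ∑ x, balanced (V (Q j)) (π₁ x) *
          (sieveWeight V T (π₁ x) * (sieveWeight (multiples G) S (π₂ x) - 1)) := by
        rw [← sub_zero (∑ x, balanced (V (Q j)) (π₁ x) * w x),
          ← sum_balanced_mul_sieveWeight (hQ j) (hindQ j hj), ← hsumX, ← Finset.sum_sub_distrib]
        refine Finset.sum_congr rfl fun x _ => ?_
        rw [hw]
        ring
      rw [h0]
      refine (norm_sum_balanced_sieveWeight_le hT (hQ j) π₁ _ _
        (norm_sum_multiplesWeight_sub_one_le hC hS)).trans ?_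
      rw [hDdef]
      gcongr
      linarith
  have hmain : ρ * (Fintype.card A - 2 ^ T.card * ((2 ^ S.card - 1) * C)) ≤ Z.card := by
    have hcard : (Z.card : ℂ) - ρ * Fintype.card A = ρ * ∑ x, sieveWeight V T (π₁ x) *
        (sieveWeight (multiples G) S (π₂ x) - 1) := by
      have hone : ∑ x, sieveWeight V T (π₁ x) = Fintype.card A := by
        rw [← sum_sieveWeight hT hind]
        simpa using hsumX 1
      rw [Finset.card_eq_sum_ones, Nat.cast_sum, Finset.sum_congr rfl
        (fun x hx => by rw [(hZ x).1 hx, Nat.cast_one] :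
          ∀ x ∈ Z, ((1 : ℕ) : ℂ) = (ρ : ℂ) * w x),
        Finset.sum_subset (Finset.subset_univ Z) fun x _ hx => (hZ x).2 hx, ← hone,
        Finset.mul_sum, Finset.mul_sum, ← Finset.sum_sub_distrib]
      refine Finset.sum_congr rfl fun x _ => ?_
      rw [hw]
      ring
    have hle := norm_sum_sieveWeight_le hT π₁ _ _ (norm_sum_multiplesWeight_sub_one_le hC hS) 0
    simp only [AddChar.zero_apply, one_mul] at hle
    have hnorm : ‖(((Z.card : ℝ) - ρ * Fintype.card A : ℝ) : ℂ)‖ ≤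
        ρ * (2 ^ T.card * ((2 ^ S.card - 1) * C)) := by
      push_cast
      rw [hcard, norm_mul, Complex.norm_of_nonneg hρ.le]
      gcongr
    rw [Complex.norm_real, Real.norm_eq_abs] at hnorm
    linarith [neg_abs_le ((Z.card : ℝ) - ρ * Fintype.card A)]
  have hcover : (Z.card : ℝ) ≤ ∑ i, ((Z.filter fun x => π₂ x ∈ multiples G (p i)).card : ℝ) +
      ∑ j, ((Z.filter fun x => π₁ x ∈ V (Q j)).card : ℝ) := by
    have hsub : Z ⊆ (Finset.univ.biUnion fun i => Z.filter fun x => π₂ x ∈ multiples G (p i)) ∪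
        Finset.univ.biUnion fun j => Z.filter fun x => π₁ x ∈ V (Q j) := by
      intro x hx
      obtain ⟨h1, h2⟩ := (Finset.mem_filter.mp hx).2
      simp only [Finset.mem_union, Finset.mem_biUnion, Finset.mem_univ, true_and,
        Finset.mem_filter, hx]
      by_cases h3 : ∀ j, π₁ x ∉ V (Q j)
      · exact Or.inl (hcon x h1 h3 h2)
      · push Not at h3
        exact Or.inr h3
    have := (Finset.card_le_card hsub).trans ((Finset.card_union_le _ _).trans
      (add_le_add Finset.card_biUnion_le Finset.card_biUnion_le))
    exact_mod_cast this
  have hfinal := hcover.trans (add_le_add (Finset.sum_le_sum fun i _ => hFp i)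
    (Finset.sum_le_sum fun j _ => hFQ j))
  simp only [Finset.sum_add_distrib, ← Finset.mul_sum, ← Finset.sum_mul, Finset.sum_sub_distrib,
    Finset.sum_const, Finset.card_univ, Fintype.card_fin, nsmul_eq_mul, mul_one] at hfinal
  have h1 : δ * Z.card ≤ (r + s - 1 + δ) * (ρ * D) := by
    rw [hδdef]
    linarith
  have h2 : (r + s - 1 + 2 * δ) * D ≤ δ * Fintype.card A := by
    refine le_of_eq_of_le ?_ (mul_le_mul_of_nonneg_left hbound hδ.le)
    rw [hDdef]
    field_simp
  have h3 : ρ * (δ * (Fintype.card A - D + 2 ^ T.card * C)) ≤ δ * Z.card := by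
    rw [hDdef]
    linarith [mul_le_mul_of_nonneg_left hmain hδ.le]
  have h4 : δ * (Fintype.card A - D + 2 ^ T.card * C) ≤ (r + s - 1 + δ) * D := by
    refine le_of_mul_le_mul_left ?_ hρ
    linarith
  have h5 : 0 < δ * (2 ^ T.card * C) := by positivity
  linarith

end MixedSieve

section Frobenius

variable (F E : Type*) [Field F] [Fintype F] [Field E] [Algebra F E]

/-- The linear endomorphism `L_f` of `E`, i.e. `f` evaluated at the Frobenius. -/
def frobEval (f : Polynomial F) : E →ₗ[F] E :=
  aeval (FiniteField.frobeniusAlgHom F E).toLinearMap f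

lemma Lf_eq_frobEval (f : Polynomial F) (α : E) : Lf (Fintype.card F) f α = frobEval F E f α := by
  have hpow : ∀ i : ℕ, ((FiniteField.frobeniusAlgHom F E).toLinearMap ^ i) α =
      α ^ Fintype.card F ^ i := by
    intro i
    induction i with
    | zero => simp
    | succ i ih =>
      rw [pow_succ', Module.End.mul_apply, ih, pow_succ, pow_mul]
      simp
  rw [frobEval, aeval_eq_sum_range, LinearMap.sum_apply]
  refine Finset.sum_congr rfl fun i _ => ?_
  rw [LinearMap.smul_apply, hpow, Algebra.smul_def]

lemma frobEval_mul_apply (f g : Polynomial F) (α : E) :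
    frobEval F E (f * g) α = frobEval F E f (frobEval F E g α) := by
  rw [frobEval, map_mul]
  rfl

lemma range_frobEval_le {f g : Polynomial F} (h : f ∣ g) :
    LinearMap.range (frobEval F E g) ≤ LinearMap.range (frobEval F E f) := by
  obtain ⟨g, rfl⟩ := h
  rintro _ ⟨α, rfl⟩
  exact ⟨_, (frobEval_mul_apply F E f g α).symm⟩

lemma card_ker_frobEval_le {f : Polynomial F} (hf : f.Monic) :
    Nat.card (LinearMap.ker (frobEval F E f)) ≤ Fintype.card F ^ f.natDegree := by
  classical
  set P : Polynomial E := ∑ i ∈ Finset.range (f.natDegree + 1),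
    C (algebraMap F E (f.coeff i)) * X ^ Fintype.card F ^ i with hP
  have hq : 1 < Fintype.card F := Fintype.one_lt_card
  have hdeg : P.natDegree ≤ Fintype.card F ^ f.natDegree := by
    refine natDegree_sum_le_of_forall_le _ _ fun i hi => (natDegree_C_mul_X_pow_le _ _).trans ?_
    exact Nat.pow_le_pow_right hq.le (Nat.lt_succ_iff.mp (Finset.mem_range.mp hi))
  have hcoeff : P.coeff (Fintype.card F ^ f.natDegree) = 1 := by
    rw [hP, finsetSum_coeff, Finset.sum_eq_single f.natDegree]
    · rw [coeff_C_mul_X_pow, if_pos rfl, hf.coeff_natDegree, map_one]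
    · intro i _ hi
      rw [coeff_C_mul_X_pow, if_neg fun h => hi (Nat.pow_right_injective hq h).symm]
    · intro h
      simp at h
  have hne : P ≠ 0 := by
    intro h0
    rw [h0, coeff_zero] at hcoeff
    exact zero_ne_one hcoeff
  have hsub : ((LinearMap.ker (frobEval F E f) : Submodule F E) : Set E) ⊆
      (P.roots.toFinset : Set E) := by
    intro α hα
    have h0 : Lf (Fintype.card F) f α = 0 := by
      rw [Lf_eq_frobEval]
      exact hα
    rw [Finset.mem_coe, Multiset.mem_toFinset, mem_roots hne, IsRoot, hP, eval_finsetSum, ← h0]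
    simp [Lf]
  calc Nat.card (LinearMap.ker (frobEval F E f))
      = Set.ncard ((LinearMap.ker (frobEval F E f) : Submodule F E) : Set E) := rfl
    _ ≤ Set.ncard (P.roots.toFinset : Set E) := Set.ncard_le_ncard hsub (Finset.finite_toSet _)
    _ ≤ P.natDegree := by
      rw [Set.ncard_coe_finset]
      exact (Multiset.toFinset_card_le _).trans (card_roots' P)
    _ ≤ _ := hdeg

variable {F E}

lemma iInf_range_frobEval_sup_eq_top {S : Finset (Polynomial F)} {Q : Polynomial F}
    (h : ∀ P ∈ S, IsCoprime P Q) :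
    (⨅ P ∈ S, (LinearMap.range (frobEval F E P)).toAddSubgroup) ⊔
      (LinearMap.range (frobEval F E Q)).toAddSubgroup = ⊤ := by
  obtain ⟨a, b, hab⟩ : IsCoprime (∏ P ∈ S, P) Q := IsCoprime.prod_left h
  refine eq_top_iff.mpr fun α _ => AddSubgroup.mem_sup.mpr
    ⟨frobEval F E (∏ P ∈ S, P) (frobEval F E a α), ?_, frobEval F E Q (frobEval F E b α), ?_, ?_⟩
  · simp only [AddSubgroup.mem_iInf]
    exact fun P hP => range_frobEval_le F E (Finset.dvd_prod_of_mem id hP) ⟨_, rfl⟩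
  · exact ⟨_, rfl⟩
  · rw [← frobEval_mul_apply, ← frobEval_mul_apply, ← LinearMap.add_apply, frobEval, frobEval,
      ← map_add, mul_comm, mul_comm Q, hab, map_one]
    rfl

variable [Finite E]

lemma finrank_ker_frobEval_le {f : Polynomial F} (hf : f.Monic) :
    Module.finrank F (LinearMap.ker (frobEval F E f)) ≤ f.natDegree := by
  have h := card_ker_frobEval_le F E hf
  rw [Module.natCard_eq_pow_finrank (K := F), Nat.card_eq_fintype_card] at h
  exact (Nat.pow_le_pow_iff_right Fintype.one_lt_card).mp h

variable {f g : Polynomial F}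

lemma frobEval_apply_of_mul_eq (hfg : f * g = X ^ Module.finrank F E - 1) (α : E) :
    frobEval F E f (frobEval F E g α) = 0 := by
  rw [← frobEval_mul_apply, hfg, ← FiniteField.minpoly_frobeniusAlgHom F E, frobEval,
    minpoly.aeval, LinearMap.zero_apply]

lemma finrank_ker_frobEval (hf : f.Monic) (hg : g.Monic)
    (hfg : f * g = X ^ Module.finrank F E - 1) :
    Module.finrank F (LinearMap.ker (frobEval F E f)) = f.natDegree := by
  have hle : LinearMap.range (frobEval F E g) ≤ LinearMap.ker (frobEval F E f) := by
    rintro _ ⟨α, rfl⟩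
    exact frobEval_apply_of_mul_eq hfg α
  have h1 := Submodule.finrank_mono hle
  have h2 := LinearMap.finrank_range_add_finrank_ker (frobEval F E g)
  have h3 := finrank_ker_frobEval_le (E := E) hf
  have h4 := finrank_ker_frobEval_le (E := E) hg
  have h5 : f.natDegree + g.natDegree = Module.finrank F E := by
    rw [← hf.natDegree_mul hg, hfg, ← C_1, natDegree_X_pow_sub_C]
  omega

lemma ker_frobEval_eq_range (hf : f.Monic) (hg : g.Monic)
    (hfg : f * g = X ^ Module.finrank F E - 1) :
    LinearMap.ker (frobEval F E f) = LinearMap.range (frobEval F E g) := by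
  have hle : LinearMap.range (frobEval F E g) ≤ LinearMap.ker (frobEval F E f) := by
    rintro _ ⟨α, rfl⟩
    exact frobEval_apply_of_mul_eq hfg α
  refine (Submodule.eq_of_le_of_finrank_eq hle ?_).symm
  have h2 := LinearMap.finrank_range_add_finrank_ker (frobEval F E g)
  have h3 := finrank_ker_frobEval hf hg hfg
  have h4 := finrank_ker_frobEval hg hf (mul_comm f g ▸ hfg)
  have h5 : f.natDegree + g.natDegree = Module.finrank F E := by
    rw [← hf.natDegree_mul hg, hfg, ← C_1, natDegree_X_pow_sub_C]
  omega

lemma index_range_frobEval (hf : f.Monic) (hg : g.Monic)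
    (hfg : f * g = X ^ Module.finrank F E - 1) :
    (LinearMap.range (frobEval F E f)).toAddSubgroup.index = Fintype.card F ^ f.natDegree := by
  have h1 : Nat.card (LinearMap.range (frobEval F E f)).toAddSubgroup *
      (LinearMap.range (frobEval F E f)).toAddSubgroup.index = Nat.card E :=
    AddSubgroup.card_mul_index _
  have h2 : Nat.card (LinearMap.range (frobEval F E f)).toAddSubgroup =
      Nat.card (LinearMap.range (frobEval F E f)) := rfl
  have h3 := LinearMap.finrank_range_add_finrank_ker (frobEval F E f)
  rw [finrank_ker_frobEval hf hg hfg] at h3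
  rw [h2, Module.natCard_eq_pow_finrank (K := F), Module.natCard_eq_pow_finrank (K := F) (V := E),
    ← h3, pow_add, Nat.card_eq_fintype_card] at h1
  exact Nat.eq_of_mul_eq_mul_left (pow_pos Fintype.card_pos _) h1

end Frobenius

lemma index_multiples_units (E : Type*) [Field E] [Finite E] {p : ℕ} (hp : p ∣ Nat.card E - 1) :
    (multiples (Additive Eˣ) p).index = p := by
  have h : (powMonoidHom p : Eˣ →* Eˣ).range.index = p := by
    rw [IsCyclic.index_powMonoidHom_range, Nat.card_units]
    exact Nat.gcd_eq_right hp
  exact h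

lemma norm_gaussSum_complex {E : Type*} [Field E] [Fintype E] {χ : MulChar E ℂ} (hχ : χ ≠ 1)
    {ψ : AddChar E ℂ} (hψ : ψ.IsPrimitive) : ‖gaussSum χ ψ‖ = √(Fintype.card E) := by
  have h := gaussSum_mul_gaussSum_eq_card hχ hψ
  rw [← star_gaussSum_eq, Complex.star_def, Complex.mul_conj, Complex.normSq_eq_norm_sq] at h
  rw [eq_comm, Real.sqrt_eq_iff_mul_self_eq (by positivity) (norm_nonneg _), ← sq]
  exact_mod_cast h.symm

/-- A mixed character sum bound along a linear map `L`. -/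
lemma norm_sum_mixed_le {E : Type*} [Field E] [Fintype E] (L : E →+ E) (χ : AddChar E ℂ)
    {η : MulChar E ℂ} (hη : η ≠ 1) :
    ‖∑ α, χ α * η (L α)‖ ≤ √(Fintype.card E) * Nat.card L.ker := by
  classical
  obtain ⟨ψ, hψ⟩ : ∃ ψ : AddChar E ℂ, ψ.IsPrimitive := by
    obtain ⟨ψ, hψ⟩ := AddChar.exists_apply_ne_zero.mpr (one_ne_zero : (1 : E) ≠ 0)
    refine ⟨ψ, AddChar.IsPrimitive.of_ne_one ?_⟩
    rintro rfl
    exact hψ (AddChar.one_apply _)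
  set c : ℝ := (Fintype.card E : ℝ) with hc
  have hcpos : 0 < c := Nat.cast_pos.mpr Fintype.card_pos
  have hη' : η⁻¹ ≠ 1 := inv_ne_one.mpr hη
  have hshift : ∀ w, η w * gaussSum η⁻¹ ψ = ∑ a, η⁻¹ a * ψ (a * w) := by
    intro w
    by_cases hw : w = 0
    · simp only [hw, mul_zero, AddChar.map_zero_eq_one, mul_one,
        MulChar.sum_eq_zero_of_ne_one hη', MulChar.map_zero, zero_mul]
    · rw [← gaussSum_mulShift η⁻¹ ψ (Units.mk0 w hw), ← mul_assoc, Units.val_mk0,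
        ← MulChar.mul_apply, mul_inv_cancel, MulChar.one_apply (Ne.isUnit hw), one_mul, gaussSum]
      simp only [AddChar.mulShift_apply, mul_comm w]
  set t : E → ℂ := fun a => ∑ α, χ α * ψ (a * L α) with ht
  have htnorm : ∀ a, (‖t a‖ : ℂ) = t a := by
    intro a
    have : t a = ∑ α, (χ + (ψ.mulShift a).compAddMonoidHom L) α := rfl
    rw [this, AddChar.sum_eq_ite]
    split_ifs <;> simp
  have hsum : ∑ a, t a = ∑ α, χ α * (if L α = 0 then (Fintype.card E : ℂ) else 0) := by
    rw [ht, Finset.sum_comm]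
    refine Finset.sum_congr rfl fun α _ => ?_
    rw [← Finset.mul_sum, AddChar.sum_mulShift _ hψ]
    split_ifs <;> simp
  have hsumnorm : ∑ a, ‖t a‖ ≤ Nat.card L.ker * c := by
    have h1 : ((∑ a, ‖t a‖ : ℝ) : ℂ) = ∑ a, t a := by
      push_cast
      exact Finset.sum_congr rfl fun a _ => htnorm a
    have h2 : ∑ a, ‖t a‖ = ‖∑ a, t a‖ := by
      rw [← h1, Complex.norm_of_nonneg (Finset.sum_nonneg fun a _ => norm_nonneg _)]
    have h3 : Nat.card L.ker = (Finset.univ.filter fun α => L α = 0).card := by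
      rw [Nat.card_eq_fintype_card, Fintype.card_subtype]
      simp only [AddMonoidHom.mem_ker]
    rw [h2, hsum, h3, Finset.card_filter, Nat.cast_sum, Finset.sum_mul]
    refine norm_sum_le_of_le _ fun α _ => ?_
    rw [norm_mul, AddChar.norm_apply, one_mul]
    split_ifs <;> simp [hc]
  have hS : (∑ α, χ α * η (L α)) * gaussSum η⁻¹ ψ = ∑ a, η⁻¹ a * t a := by
    simp only [Finset.sum_mul, mul_assoc, hshift, ht, Finset.mul_sum]
    rw [Finset.sum_comm]
    exact Finset.sum_congr rfl fun a _ => Finset.sum_congr rfl fun α _ => mul_left_comm _ _ _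
  have hle : ‖∑ α, χ α * η (L α)‖ * √c ≤ Nat.card L.ker * c := by
    rw [hc, ← norm_gaussSum_complex hη' hψ, ← norm_mul, hS]
    refine (norm_sum_le_of_le _ fun a _ => ?_).trans hsumnorm
    rw [norm_mul]
    refine mul_le_of_le_one_left (norm_nonneg _) ?_
    by_cases ha : a = 0
    · rw [ha, MulChar.map_zero, norm_zero]
      exact zero_le_one
    · exact (Complex.norm_eq_one_of_mem_rootsOfUnity
        (η⁻¹.apply_mem_rootsOfUnity (Units.mk0 a ha))).le
  refine le_of_mul_le_mul_right (hle.trans_eq ?_) (Real.sqrt_pos.mpr hcpos)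
  rw [mul_right_comm, Real.mul_self_sqrt hcpos.le, mul_comm]

/-- `norm_sum_mixed_le` for characters of the unit group. -/
lemma norm_sum_mixed_units_le {E : Type*} [Field E] [Fintype E] (L : E →+ E)
    [Fintype {α : E // L α ≠ 0}] (χ : AddChar E ℂ) {η : AddChar (Additive Eˣ) ℂ} (hη : η ≠ 0) :
    ‖∑ x : {α : E // L α ≠ 0}, χ x * η (Additive.ofMul (Units.mk0 (L x) x.2))‖ ≤
      √(Fintype.card E) * Nat.card L.ker := by
  classical
  set η₀ : Eˣ →* ℂ := η.toMonoidHom with hη₀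
  set ψ : MulChar E ℂ := MulChar.ofUnitHom η₀.toHomUnits with hψ
  have hval : ∀ u : Eˣ, ψ u = η (Additive.ofMul u) := fun u => by
    rw [hψ, MulChar.ofUnitHom_coe, MonoidHom.coe_toHomUnits]
    rfl
  have hψ1 : ψ ≠ 1 := by
    intro h
    refine hη ?_
    ext u
    have := hval u.toMul
    rw [h, MulChar.one_apply_coe] at this
    exact this.symm
  refine le_of_eq_of_le ?_ (norm_sum_mixed_le L χ hψ1)
  congr 1
  refine Fintype.sum_of_injective Subtype.val Subtype.val_injective _ _ ?_ fun x => ?_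
  · intro α hα
    have : L α = 0 := by
      by_contra h
      exact hα ⟨⟨α, h⟩, rfl⟩
    rw [this, MulChar.map_zero, mul_zero]
  · rw [← hval, Units.val_mk0]

lemma two_pow_card_le_card_squarefree {M : Type*} [CommMonoidWithZero M] [IsCancelMulZero M]
    [DecompositionMonoid M] {S : Finset M} {P : M → Prop} (y : M) (hS : ∀ p ∈ S, Prime p ∧ p ∣ y)
    (hinj : ∀ p ∈ S, ∀ q ∈ S, p ∣ q → p = q) (hP : ∀ S' ⊆ S, P (∏ p ∈ S', p))
    (hfin : Finite {d : M // P d ∧ Squarefree d ∧ d ∣ y}) :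
    2 ^ S.card ≤ Nat.card {d : M // P d ∧ Squarefree d ∧ d ∣ y} := by
  classical
  have hrel : ∀ S' ⊆ S, (S' : Set M).Pairwise (Function.onFun IsRelPrime fun p => p) := by
    intro S' hS' p hp q hq hpq
    exact (hS p (hS' hp)).1.irreducible.isRelPrime_iff_not_dvd.mpr fun h =>
      hpq (hinj p (hS' hp) q (hS' hq) h)
  have hprod : ∀ S' ⊆ S, P (∏ p ∈ S', p) ∧ Squarefree (∏ p ∈ S', p) ∧ ∏ p ∈ S', p ∣ y :=
    fun S' hS' => ⟨hP S' hS',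
      Finset.squarefree_prod_of_pairwise_isCoprime (hrel S' hS') fun p hp =>
        (hS p (hS' hp)).1.irreducible.squarefree,
      Finset.prod_dvd_of_isRelPrime (hrel S' hS') fun p hp => (hS p (hS' hp)).2⟩
  rw [← Finset.card_powerset, ← Fintype.card_coe, ← Nat.card_eq_fintype_card]
  refine Nat.card_le_card_of_injective
    (fun S' : {x // x ∈ S.powerset} => (⟨∏ p ∈ S'.1, p, hprod S'.1 (Finset.mem_powerset.mp S'.2)⟩ :
      {d : M // P d ∧ Squarefree d ∧ d ∣ y})) fun S₁ S₂ h => ?_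
  have hmem : ∀ S' ⊆ S, ∀ p ∈ S, (p ∈ S' ↔ p ∣ ∏ q ∈ S', q) := by
    intro S' hS' p hp
    refine ⟨fun h => Finset.dvd_prod_of_mem (fun q => q) h, fun h => ?_⟩
    obtain ⟨q, hq, hpq⟩ := ((hS p hp).1.dvd_finsetProd_iff _).mp h
    exact hinj p hp q (hS' hq) hpq ▸ hq
  have h1 := Finset.mem_powerset.mp S₁.2
  have h2 := Finset.mem_powerset.mp S₂.2
  have heq : ∏ p ∈ S₁.1, p = ∏ p ∈ S₂.1, p := congrArg Subtype.val h
  ext p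
  refine ⟨fun hp => (hmem _ h2 p (h1 hp)).mpr ?_, fun hp => (hmem _ h1 p (h2 hp)).mpr ?_⟩
  · exact heq ▸ (hmem _ h1 p (h1 hp)).mp hp
  · exact heq ▸ (hmem _ h2 p (h2 hp)).mp hp

lemma two_pow_le_Wnat {m : ℕ} (hm : m ≠ 0) : 2 ^ m.primeFactors.card ≤ Wnat m := by
  have hfin : Finite {d : ℕ // True ∧ Squarefree d ∧ d ∣ m} :=
    ((Set.finite_Iic m).subset fun d (hd : True ∧ Squarefree d ∧ d ∣ m) =>
      Nat.le_of_dvd (Nat.pos_of_ne_zero hm) hd.2.2).to_subtype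
  refine (two_pow_card_le_card_squarefree (P := fun _ => True) m (fun p hp => ?_)
    (fun p hp q hq hpq => ?_) (fun _ _ => trivial) hfin).trans_eq ?_
  · exact ⟨(Nat.prime_of_mem_primeFactors hp).prime, Nat.dvd_of_mem_primeFactors hp⟩
  · exact (Nat.prime_dvd_prime_iff_eq (Nat.prime_of_mem_primeFactors hp)
      (Nat.prime_of_mem_primeFactors hq)).mp hpq
  · exact Nat.card_congr (Equiv.subtypeEquivRight fun d => by tauto)

section MonicFactors

variable {F : Type*} [Field F]

/-- The distinct monic irreducible factors of `T`. -/
def monicFactors (T : Polynomial F) : Finset (Polynomial F) :=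
  letI := Classical.decEq F
  (UniqueFactorizationMonoid.normalizedFactors T).toFinset

lemma mem_monicFactors {P T : Polynomial F} (hT : T ≠ 0) :
    P ∈ monicFactors T ↔ Irreducible P ∧ P.Monic ∧ P ∣ T := by
  classical
  unfold monicFactors
  rw [Multiset.mem_toFinset, Polynomial.mem_normalizedFactors_iff hT]

lemma radPoly_eq_prod (T : Polynomial F) : radPoly T = ∏ P ∈ monicFactors T, P := rfl

lemma eq_of_monic_irreducible_of_dvd {P Q : Polynomial F} (hP : P.Monic) (hPi : Irreducible P)
    (hQ : Q.Monic) (hQi : Irreducible Q) (h : P ∣ Q) : P = Q :=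
  eq_of_monic_of_associated hP hQ (hPi.associated_of_dvd hQi h)

lemma dvd_of_dvd_radPoly {P T : Polynomial F} (hT : T ≠ 0) (hP : Irreducible P)
    (h : P ∣ radPoly T) : P ∣ T := by
  obtain ⟨R, hR, hPR⟩ := (hP.prime.dvd_finsetProd_iff _).mp (radPoly_eq_prod T ▸ h)
  exact hPR.trans ((mem_monicFactors hT).mp hR).2.2

lemma dvd_radPoly {P T : Polynomial F} (hT : T ≠ 0) (hP : Irreducible P) (hPm : P.Monic)
    (h : P ∣ T) : P ∣ radPoly T :=
  Finset.dvd_prod_of_mem (fun P => P) ((mem_monicFactors hT).mpr ⟨hP, hPm, h⟩)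

lemma exists_monic_irreducible_dvd {h : Polynomial F} (hm : h.Monic) (h1 : h ≠ 1) :
    ∃ P, Irreducible P ∧ P.Monic ∧ P ∣ h := by
  obtain ⟨P, hPm, hPi, hPh⟩ := exists_monic_irreducible_factor h fun hu =>
    h1 (hm.isUnit_iff.mp hu)
  exact ⟨P, hPi, hPm, hPh⟩

lemma two_pow_le_Wpoly [Finite F] {T : Polynomial F} (hT : T ≠ 0) :
    2 ^ (monicFactors T).card ≤ Wpoly T := by
  have hfin : Finite {h : Polynomial F // h.Monic ∧ Squarefree h ∧ h ∣ T} := by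
    have := Fintype.ofFinite F
    have : Finite (Polynomial F)ˣ :=
      Finite.of_injective (fun u : (Polynomial F)ˣ => (u : Polynomial F).coeff 0) fun u v huv => by
        ext1
        rw [eq_C_of_natDegree_eq_zero (natDegree_eq_zero_of_isUnit u.isUnit),
          eq_C_of_natDegree_eq_zero (natDegree_eq_zero_of_isUnit v.isUnit)]
        exact congrArg C huv
    have := Fintype.ofFinite (Polynomial F)ˣ
    have := UniqueFactorizationMonoid.fintypeSubtypeDvd T hT
    exact Finite.of_injective (fun h : {h : Polynomial F // h.Monic ∧ Squarefree h ∧ h ∣ T} =>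
      (⟨h.1, h.2.2.2⟩ : {h : Polynomial F // h ∣ T})) fun h₁ h₂ h => by
        ext1
        exact congrArg (fun x => x.1) h
  refine two_pow_card_le_card_squarefree T (fun P hP => ?_) (fun P hP Q hQ h => ?_)
    (fun S' hS' => ?_) hfin
  · rw [mem_monicFactors hT] at hP
    exact ⟨hP.1.prime, hP.2.2⟩
  · rw [mem_monicFactors hT] at hP hQ
    exact eq_of_monic_irreducible_of_dvd hP.2.1 hP.1 hQ.2.1 hQ.1 h
  · exact monic_prod_of_monic _ _ fun P hP => ((mem_monicFactors hT).mp (hS' hP)).2.1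

end MonicFactors

lemma dvd_radNat_iff {p m : ℕ} (hp : p.Prime) (hm : m ≠ 0) : p ∣ radNat m ↔ p ∣ m := by
  refine ⟨fun h => h.trans (Nat.prod_primeFactors_dvd m), fun h => ?_⟩
  exact Finset.dvd_prod_of_mem (fun p => p) (Nat.mem_primeFactors.mpr ⟨hp, h, hm⟩)

/-- Sieving criterion: with `rad(x^n-1) = rad(T)·Q_1⋯Q_s` and `rad(q^n-1) = rad(m)·p_1⋯p_r`,
if `δ = 1 - Σ 1/p_i - Σ 1/q^{deg Q_j} > 0`, `Δ = (r+s-1)/δ + 2` and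
`q^{n/2-k} ≥ W(m)·W(T)·Δ`, then `N_f(x^n - 1, q^n - 1) > 0`. -/
theorem Nf_pos_of_sieve_bound (q n k : ℕ) (hn : 0 < n)
    (F E : Type*) [Field F] [Fintype F] [Field E] [Fintype E] [Algebra F E]
    (hF : Fintype.card F = q) (hE : Fintype.card E = q ^ n)
    (f T : Polynomial F) (hfm : f.Monic) (hTm : T.Monic)
    (hfd : f ∣ (X : Polynomial F) ^ n - 1) (hTd : T ∣ (X : Polynomial F) ^ n - 1)
    (hk : f.natDegree = k)
    (hncop : ¬ IsCoprime (((X : Polynomial F) ^ n - 1) / f) T)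
    (m : ℕ) (hm : 0 < m) (hmd : m ∣ q ^ n - 1)
    (r s : ℕ) (p : Fin r → ℕ) (hp : ∀ i, (p i).Prime)
    (Q : Fin s → Polynomial F) (hQ : ∀ j, (Q j).Monic ∧ Irreducible (Q j))
    (hradP : radPoly ((X : Polynomial F) ^ n - 1) = radPoly T * ∏ j, Q j)
    (hradN : radNat (q ^ n - 1) = radNat m * ∏ i, p i)
    (δ : ℝ)
    (hδdef : δ = 1 - (∑ i, (1 : ℝ) / (p i : ℝ)) - ∑ j, (1 : ℝ) / (q : ℝ) ^ (Q j).natDegree)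
    (hδ : 0 < δ)
    (hbound : (Wnat m : ℝ) * (Wpoly T : ℝ) * (((r : ℝ) + (s : ℝ) - 1) / δ + 2)
      ≤ (q : ℝ) ^ ((n : ℝ) / 2 - (k : ℝ))) :
    0 < Nf q F E f ((X : Polynomial F) ^ n - 1) (q ^ n - 1) := by
  classical
  subst hF
  set q := Fintype.card F with hq
  have hq1 : 1 < q := Fintype.one_lt_card
  have hn0 : n = Module.finrank F E := by
    have h := Module.card_eq_pow_finrank (K := F) (V := E)
    rw [hE] at h
    exact Nat.pow_right_injective hq1 h
  have hXm : ((X : Polynomial F) ^ n - 1).Monic := monic_X_pow_sub_C 1 hn.ne'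
  have hX0 : (X : Polynomial F) ^ n - 1 ≠ 0 := hXm.ne_zero
  have hqn : 1 < q ^ n := Nat.one_lt_pow hn.ne' hq1
  have hqn0 : q ^ n - 1 ≠ 0 := by omega
  have hcodvd : ∀ P : Polynomial F, P.Monic → P ∣ X ^ n - 1 →
      ∃ g : Polynomial F, g.Monic ∧ P * g = X ^ Module.finrank F E - 1 := by
    rintro P hP ⟨g, hg⟩
    refine ⟨g, hP.of_mul_monic_left (hg ▸ hXm), ?_⟩
    rw [← hn0, hg]
  have hindexV : ∀ P : Polynomial F, P.Monic → P ∣ X ^ n - 1 →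
      (LinearMap.range (frobEval F E P)).toAddSubgroup.index = q ^ P.natDegree := by
    intro P hP hPd
    obtain ⟨g, hg, hPg⟩ := hcodvd P hP hPd
    exact index_range_frobEval hP hg hPg
  have hcardE : Nat.card E - 1 = q ^ n - 1 := by rw [Nat.card_eq_fintype_card, hE]
  have hindexW : ∀ l, l ∣ q ^ n - 1 → (multiples (Additive Eˣ) l).index = l :=
    fun l hl => index_multiples_units E (hcardE ▸ hl)
  have hirr : ∀ P : Polynomial F, Irreducible P → 1 < q ^ P.natDegree := fun P hP =>
    Nat.one_lt_pow hP.natDegree_pos.ne' hq1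
  have hTfac := fun P => mem_monicFactors (P := P) hTm.ne_zero
  have hQdvd : ∀ j, Q j ∣ X ^ n - 1 := fun j => dvd_of_dvd_radPoly hX0 (hQ j).2 <| hradP ▸
    (Finset.dvd_prod_of_mem Q (Finset.mem_univ j)).mul_left _
  have hpdvd : ∀ i, p i ∣ q ^ n - 1 := fun i => (dvd_radNat_iff (hp i) hqn0).mp <| hradN ▸
    (Finset.dvd_prod_of_mem p (Finset.mem_univ i)).mul_left _
  have hcop : ∀ P Q : Polynomial F, Irreducible P → P.Monic → Irreducible Q → Q.Monic → P ≠ Q →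
      IsCoprime P Q := fun P Q hP hPm hQ hQm hPQ => hP.coprime_iff_not_dvd.mpr fun h =>
    hPQ (eq_of_monic_irreducible_of_dvd hPm hP hQm hQ h)
  obtain ⟨g, hg, hfg⟩ := hcodvd f hfm hfd
  have hdiv : ((X : Polynomial F) ^ n - 1) / f = g := by
    rw [hn0, ← hfg, mul_div_cancel_left₀ _ hfm.ne_zero]
  obtain ⟨P₀, hP₀, hP₀m, hP₀g, hP₀T⟩ :
      ∃ P : Polynomial F, Irreducible P ∧ P.Monic ∧ P ∣ g ∧ P ∣ T := by
    rw [hdiv, ← EuclideanDomain.gcd_isUnit_iff] at hncop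
    obtain ⟨P, hPm, hPi, hPd⟩ := exists_monic_irreducible_factor _ hncop
    exact ⟨P, hPi, hPm, hPd.trans (EuclideanDomain.gcd_dvd_left _ _),
      hPd.trans (EuclideanDomain.gcd_dvd_right _ _)⟩
  set L : E →+ E := (frobEval F E f).toAddMonoidHom with hL
  have hLker : Nat.card L.ker = q ^ k := by
    have h : Nat.card L.ker = Nat.card (LinearMap.ker (frobEval F E f)) := rfl
    rw [h, Module.natCard_eq_pow_finrank (K := F), finrank_ker_frobEval hfm hg hfg,
      Nat.card_eq_fintype_card, hk]
  have hcard : (Fintype.card E : ℝ) = (q : ℝ) ^ n := by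
    rw [hE]
    push_cast
    rfl
  have hq0 : (0 : ℝ) < q := by exact_mod_cast (by omega : 0 < q)
  set B : ℝ := √(Fintype.card E) * Nat.card L.ker with hB
  have hBpos : 0 < B := by
    rw [hB, hcard, hLker]
    push_cast
    positivity
  have hBrpow : (q : ℝ) ^ ((n : ℝ) / 2 - k) * B = Fintype.card E := by
    have hsqrt : (q : ℝ) ^ ((n : ℝ) / 2) = √((q : ℝ) ^ n) := by
      rw [Real.sqrt_eq_rpow, ← Real.rpow_natCast, ← Real.rpow_mul hq0.le, mul_one_div]
    rw [hB, hcard, hLker, Real.rpow_sub hq0, Real.rpow_natCast, hsqrt, Nat.cast_pow,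
      div_mul_eq_mul_div, div_eq_iff (by positivity), ← mul_assoc,
      Real.mul_self_sqrt (by positivity)]
  refine Exists.elim (exists_unsieved_of_sieve_bound
    (X := {α : E // L α ≠ 0}) (π₁ := Subtype.val)
    (π₂ := fun x => Additive.ofMul (Units.mk0 (L x) x.2)) (C := B) (S := m.primeFactors)
    (V := fun P : Polynomial F => (LinearMap.range (frobEval F E P)).toAddSubgroup)
    (T := monicFactors T) (p := p) (Q := Q) (δ := δ) Subtype.val_injective ?_ hBpos
    (fun χ η hη => norm_sum_mixed_units_le L χ hη) ?_ ?_ ?_ ?_ ?_ ?_ ?_ hδ ?_) ?_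
  · intro α hα
    refine ⟨⟨α, fun h0 => hα P₀ ((hTfac P₀).mpr ⟨hP₀, hP₀m, hP₀T⟩) ?_⟩, rfl⟩
    have : α ∈ LinearMap.ker (frobEval F E f) := h0
    rw [ker_frobEval_eq_range hfm hg hfg] at this
    exact range_frobEval_le F E hP₀g this
  · intro l hl
    have hlp := Nat.prime_of_mem_primeFactors hl
    rw [hindexW l ((Nat.dvd_of_mem_primeFactors hl).trans hmd)]
    exact ⟨hlp, hlp.one_lt⟩
  · intro P hP
    obtain ⟨hPi, hPm, hPT⟩ := (hTfac P).mp hP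
    rw [hindexV P hPm (hPT.trans hTd)]
    exact hirr P hPi
  · intro T' hT' R hR hRT'
    obtain ⟨hRi, hRm, _⟩ := (hTfac R).mp hR
    refine iInf_range_frobEval_sup_eq_top fun P hP => ?_
    obtain ⟨hPi, hPm, _⟩ := (hTfac P).mp (hT' hP)
    exact hcop P R hPi hPm hRi hRm fun h => hRT' (h ▸ hP)
  · intro i
    rw [hindexW _ (hpdvd i)]
    exact ⟨hp i, (hp i).one_lt⟩
  · intro j
    rw [hindexV _ (hQ j).1 (hQdvd j)]
    exact hirr _ (hQ j).2
  · intro j hj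
    refine iInf_range_frobEval_sup_eq_top fun P hP => ?_
    obtain ⟨hPi, hPm, _⟩ := (hTfac P).mp hP
    exact hcop P _ hPi hPm (hQ j).2 (hQ j).1 fun h => hj (h ▸ hP)
  · rw [hδdef]
    congr 1
    · congr 1
      exact Finset.sum_congr rfl fun i _ => by rw [hindexW _ (hpdvd i)]
    · refine Finset.sum_congr rfl fun j _ => ?_
      rw [hindexV _ (hQ j).1 (hQdvd j)]
      push_cast
      rfl
  · have hp1 : ∑ i, 1 / (p i : ℝ) ≤ r := by
      refine (Finset.sum_le_card_nsmul _ _ 1 fun i _ => ?_).trans_eq (by simp)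
      exact div_le_one_of_le₀ (by exact_mod_cast (hp i).one_lt.le) (Nat.cast_nonneg _)
    have hQ1 : ∑ j, 1 / (q : ℝ) ^ (Q j).natDegree ≤ s := by
      refine (Finset.sum_le_card_nsmul _ _ 1 fun j _ => ?_).trans_eq (by simp)
      exact div_le_one_of_le₀ (by exact_mod_cast (hirr _ (hQ j).2).le) (by positivity)
    have hδ1 : 0 ≤ (r : ℝ) + s - 1 + δ := by
      rw [hδdef]
      linarith
    have hΔ : 0 ≤ ((r : ℝ) + s - 1) / δ + 2 := by
      have : ((r : ℝ) + s - 1) / δ + 2 = (r + s - 1 + δ) / δ + 1 := by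
        field_simp
        ring
      rw [this]
      positivity
    have h1 : (2 : ℝ) ^ m.primeFactors.card ≤ Wnat m := by
      exact_mod_cast two_pow_le_Wnat hm.ne'
    have h2 : (2 : ℝ) ^ (monicFactors T).card ≤ Wpoly T := by
      exact_mod_cast two_pow_le_Wpoly hTm.ne_zero
    rw [← hBrpow]
    refine mul_le_mul_of_nonneg_right (le_trans ?_ hbound) hBpos.le
    gcongr
  · rintro x ⟨hxT, hxQ, hxm, hxp⟩
    refine Nat.card_pos_iff.mpr ⟨⟨x.1, fun h hhm hhd hh => ?_, ?_, fun d hd hβ => ?_⟩,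
      inferInstance⟩
    · by_contra hne
      obtain ⟨β, hβ⟩ := hh
      obtain ⟨P, hPi, hPm, hPh⟩ := exists_monic_irreducible_dvd hhm hne
      have hmem : x.1 ∈ LinearMap.range (frobEval F E P) :=
        range_frobEval_le F E hPh ⟨β, by rw [← hβ, Lf_eq_frobEval]⟩
      have hPr := dvd_radPoly hX0 hPi hPm (hPh.trans hhd)
      rw [hradP, hPi.prime.dvd_mul] at hPr
      rcases hPr with hPr | hPr
      · exact hxT P ((hTfac P).mpr ⟨hPi, hPm, dvd_of_dvd_radPoly hTm.ne_zero hPi hPr⟩) hmem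
      · obtain ⟨j, _, hj⟩ := (hPi.prime.dvd_finsetProd_iff _).mp hPr
        rw [eq_of_monic_irreducible_of_dvd hPm hPi (hQ j).1 (hQ j).2 hj] at hmem
        exact hxQ j hmem
    · rw [Lf_eq_frobEval]
      exact x.2
    · by_contra hd1
      obtain ⟨β, hβ⟩ := hβ
      rw [Lf_eq_frobEval] at hβ
      obtain ⟨l, hl, hld⟩ := Nat.exists_prime_and_dvd hd1
      have hmem : Additive.ofMul (Units.mk0 (L x) x.2) ∈ multiples (Additive Eˣ) l := by
        obtain ⟨e, rfl⟩ := hld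
        have hLx : L x = (β ^ e) ^ l := by rw [← pow_mul, mul_comm, ← hβ]; rfl
        have h0 : β ^ e ≠ 0 := fun h0 => x.2 (by rw [hLx, h0, zero_pow hl.ne_zero])
        refine ⟨Additive.ofMul (Units.mk0 _ h0), ?_⟩
        refine congrArg Additive.ofMul (a₁ := Units.mk0 _ h0 ^ l) (Units.ext ?_)
        simp [hLx]
      have hlr := (dvd_radNat_iff hl hqn0).mpr (hld.trans hd)
      rw [hradN, hl.dvd_mul] at hlr
      rcases hlr with hlr | hlr
      · exact hxm l (Nat.mem_primeFactors.mpr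
          ⟨hl, (dvd_radNat_iff hl hm.ne').mp hlr, hm.ne'⟩) hmem
      · obtain ⟨i, _, hi⟩ := (hl.prime.dvd_finsetProd_iff _).mp hlr
        rw [(Nat.prime_dvd_prime_iff_eq hl (hp i)).mp hi] at hmem
        exact hxp i hmem

end
end

section
/- Let p be a prime, q a power of p, and n = p^α · n_0 ≥ 5 with p not dividing n_0 and n_0 | q − 1. If q^{n/2 − 2} ≥ min(q², n²) · W(q^n − 1), then N_f(x^n − 1, q^n − 1) > 0 for every monic factor f of degree 2 of x^n − 1 in F_q[x]. -/
open Polynomial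

noncomputable section

theorem norm_gaussSum_le {E : Type*} [Field E] [Fintype E] {χ : MulChar E ℂ} (hχ : χ ≠ 1)
    (ψ : AddChar E ℂ) : ‖gaussSum χ ψ‖ ≤ √(Fintype.card E : ℝ) := by
  by_cases hψ : ψ = 1
  · rw [hψ, gaussSum_one_right hχ, norm_zero]
    exact Real.sqrt_nonneg _
  · have h := gaussSum_mul_gaussSum_eq_card hχ (AddChar.IsPrimitive.of_ne_one hψ)
    rw [← star_gaussSum_eq] at h
    apply Real.le_sqrt_of_sq_le
    have h2 := congrArg norm h
    rw [norm_mul, norm_star, Complex.norm_natCast] at h2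
    rw [sq, h2]

/-- The number of zeros of `L`. -/
def zeroCard {E : Type*} [Field E] [Fintype E] (L : E →+ E) : ℕ :=
  Nat.card {x : E // L x = 0}

theorem sum_addChar_sum_comp {E : Type*} [Field E] [Fintype E] (L : E →+ E) :
    ∑ ψ : AddChar E ℂ, ‖∑ x, ψ (L x)‖ = Fintype.card E * zeroCard L := by
  classical
  have h1 : ∀ ψ : AddChar E ℂ, ((‖∑ x, ψ (L x)‖ : ℝ) : ℂ) = ∑ x, ψ (L x) := by
    intro ψ
    have := AddChar.sum_eq_ite (ψ.compAddMonoidHom L)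
    simp only [AddChar.compAddMonoidHom_apply] at this
    rw [this]
    split_ifs <;> simp
  have h2 : ((∑ ψ : AddChar E ℂ, ‖∑ x, ψ (L x)‖ : ℝ) : ℂ) = Fintype.card E * zeroCard L := by
    push_cast
    simp_rw [h1]
    rw [Finset.sum_comm]
    simp_rw [AddChar.sum_apply_eq_ite]
    rw [← Finset.sum_filter, Finset.sum_const, zeroCard, Nat.card_eq_fintype_card,
      Fintype.card_subtype, nsmul_eq_mul, mul_comm]
  exact_mod_cast h2

theorem norm_sum_mulChar_comp_le {E : Type*} [Field E] [Fintype E] {χ : MulChar E ℂ}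
    (hχ : χ ≠ 1) (L : E →+ E) :
    ‖∑ x, χ (L x)‖ ≤ zeroCard L * √(Fintype.card E : ℝ) := by
  classical
  have hE : (0 : ℝ) < Fintype.card E := by exact_mod_cast Fintype.card_pos
  have key : (Fintype.card E : ℂ) * ∑ x, χ (L x) =
      ∑ ψ : AddChar E ℂ, (∑ x, ψ (L x)) * gaussSum χ ψ⁻¹ := by
    simp_rw [gaussSum, Finset.sum_mul_sum]
    rw [Finset.sum_comm, Finset.mul_sum]
    refine Finset.sum_congr rfl fun x _ => ?_
    rw [Finset.sum_comm]
    have : ∀ b : E, ∑ ψ : AddChar E ℂ, ψ (L x) * (χ b * ψ⁻¹ b) =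
        if L x - b = 0 then Fintype.card E * χ b else 0 := by
      intro b
      have h := AddChar.sum_apply_eq_ite (L x - b)
      have : ∀ ψ : AddChar E ℂ, ψ (L x) * (χ b * ψ⁻¹ b) = χ b * ψ (L x - b) := by
        intro ψ
        rw [AddChar.inv_apply, sub_eq_add_neg, AddChar.map_add_eq_mul]
        ring
      simp_rw [this]
      rw [← Finset.mul_sum, h]
      split_ifs <;> ring
    simp_rw [this, sub_eq_zero]
    simp
  have h := congrArg norm key
  rw [norm_mul, Complex.norm_natCast] at h
  have h3 : (Fintype.card E : ℝ) * ‖∑ x, χ (L x)‖ ≤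
      Fintype.card E * (zeroCard L * √(Fintype.card E : ℝ)) := by
    rw [h, ← mul_assoc, ← sum_addChar_sum_comp, Finset.sum_mul]
    refine (norm_sum_le _ _).trans (Finset.sum_le_sum fun ψ _ => ?_)
    rw [norm_mul]
    gcongr
    exact norm_gaussSum_le hχ _
  exact le_of_mul_le_mul_left h3 hE

/-- A multiplicative character detecting `ℓ`-th powers. -/
theorem exists_mulChar_eq_one_iff_pow {E : Type*} [Field E] [Fintype E] {l : ℕ}
    (hl : l.Prime) (hdvd : l ∣ Fintype.card E - 1) :
    ∃ χ : MulChar E ℂ, orderOf χ = l ∧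
      ∀ b : E, b ≠ 0 → (χ b = 1 ↔ ∃ c : E, b = c ^ l) := by
  obtain ⟨χ, hχ⟩ := MulChar.exists_mulChar_orderOf E hdvd
    (Complex.isPrimitiveRoot_exp l hl.ne_zero)
  refine ⟨χ, hχ, fun b hb => ⟨fun h => ?_, ?_⟩⟩
  · obtain ⟨g, hg⟩ := IsCyclic.exists_generator (α := Eˣ)
    obtain ⟨k, hk⟩ := mem_powers_iff_mem_zpowers.2 (hg (Units.mk0 b hb))
    have hb' : b = (g : E) ^ k := by
      have := congrArg (Units.val) hk
      simpa using this.symm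
    have hgl : (χ g) ^ l = 1 := by
      rw [← MulChar.pow_apply_coe, ← hχ, pow_orderOf_eq_one, MulChar.one_apply_coe]
    have hg1 : χ g ≠ 1 := by
      intro h1
      have : χ = 1 := by
        rw [MulChar.eq_iff hg, h1, MulChar.one_apply_coe]
      rw [this, orderOf_one] at hχ
      exact hl.one_lt.ne hχ
    have := Fact.mk hl
    have ho : orderOf (χ g) = l := orderOf_eq_prime hgl hg1
    obtain ⟨m, rfl⟩ : l ∣ k := by
      rw [← ho]
      apply orderOf_dvd_of_pow_eq_one
      rw [← map_pow, ← hb', h]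
    exact ⟨(g : E) ^ m, by rw [hb', ← pow_mul, mul_comm]⟩
  · rintro ⟨c, rfl⟩
    have hc : c ≠ 0 := by
      rintro rfl
      exact hb (zero_pow hl.ne_zero)
    lift c to Eˣ using isUnit_iff_ne_zero.2 hc
    rw [map_pow, ← MulChar.pow_apply_coe, ← hχ, pow_orderOf_eq_one, MulChar.one_apply_coe]

open Classical in
/-- The indicator function of the elements that are not `l`-th powers. -/
def notPow {E : Type*} [Field E] (l : ℕ) (b : E) : ℂ := if ∃ c : E, b = c ^ l then 0 else 1

theorem exists_mulChar_mul_notPow {E : Type*} [Field E] [Fintype E] {l : ℕ}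
    (hl : l.Prime) (hdvd : l ∣ Fintype.card E - 1) :
    ∃ χ : MulChar E ℂ, orderOf χ = l ∧ ∀ (η : MulChar E ℂ) (b : E),
      η b * notPow l b = (1 - (l : ℂ)⁻¹) * η b -
        (l : ℂ)⁻¹ * ∑ j ∈ Finset.Ico 1 l, (η * χ ^ j) b := by
  obtain ⟨χ, hχ, h⟩ := exists_mulChar_eq_one_iff_pow hl hdvd
  refine ⟨χ, hχ, fun η b => ?_⟩
  have hl0 : (l : ℂ) ≠ 0 := Nat.cast_ne_zero.2 hl.ne_zero
  by_cases hb : b = 0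
  · simp [hb, MulChar.map_zero]
  lift b to Eˣ using isUnit_iff_ne_zero.2 hb
  have hsum : ∑ j ∈ Finset.Ico 1 l, (η * χ ^ j) (b : E) =
      η b * (∑ j ∈ Finset.range l, χ b ^ j) - η b := by
    rw [Finset.range_eq_Ico, Finset.sum_eq_sum_Ico_succ_bot hl.pos, pow_zero, mul_add, mul_one,
      add_sub_cancel_left, Finset.mul_sum]
    simp [MulChar.mul_apply, MulChar.pow_apply_coe]
  rw [hsum, notPow]
  split_ifs with hp
  · rw [(h b hb).2 hp]
    simp only [one_pow, Finset.sum_const, Finset.card_range, nsmul_eq_mul, mul_one, mul_zero]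
    field_simp
    ring
  · have h1 : χ b ≠ 1 := fun h1 => hp ((h b hb).1 h1)
    have hz : ∑ j ∈ Finset.range l, χ (b : E) ^ j = 0 := by
      rw [geom_sum_eq h1, ← MulChar.pow_apply_coe, ← hχ, pow_orderOf_eq_one,
        MulChar.one_apply_coe, sub_self, zero_div]
    rw [hz]
    ring

/-- A bound for all nontrivial character sums controls the number of values avoiding
`l`-th powers for all `l ∈ S`. -/
theorem norm_sum_prod_notPow_sub_le {E ι : Type*} [Field E] [Fintype E] [Fintype ι] (u : ι → E)
    {B : ℝ} (hu : ∀ χ : MulChar E ℂ, χ ≠ 1 → ‖∑ x, χ (u x)‖ ≤ B)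
    (S : Finset ℕ) (hS : ∀ l ∈ S, l.Prime ∧ l ∣ Fintype.card E - 1) :
    (∀ (N : ℕ) (η : MulChar E ℂ), (∀ l ∈ S, N.Coprime l) → η ^ N = 1 → η ≠ 1 →
      ‖∑ x, η (u x) * ∏ l ∈ S, notPow l (u x)‖ ≤ (∏ l ∈ S, (1 - (l : ℝ)⁻¹)) * 2 ^ S.card * B) ∧
    ‖∑ x, (1 : MulChar E ℂ) (u x) * ∏ l ∈ S, notPow l (u x) -
      (∏ l ∈ S, (1 - (l : ℂ)⁻¹)) * ∑ x, (1 : MulChar E ℂ) (u x)‖ ≤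
      (∏ l ∈ S, (1 - (l : ℝ)⁻¹)) * (2 ^ S.card - 1) * B := by
  classical
  induction S using Finset.induction_on with
  | empty =>
    refine ⟨fun N η _ _ hη => by simpa using hu η hη, by simp⟩
  | insert l S hlS ih =>
    obtain ⟨ih1, ih2⟩ := ih fun k hk => hS k (Finset.mem_insert_of_mem hk)
    obtain ⟨hl, hdvd⟩ := hS l (Finset.mem_insert_self _ _)
    obtain ⟨χ, hχ, hmul⟩ := exists_mulChar_mul_notPow hl hdvd
    set θ : ℝ := ∏ l ∈ S, (1 - (l : ℝ)⁻¹) with hθ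
    have hl1 : (1 : ℝ) ≤ l := by exact_mod_cast hl.one_le
    have hl0 : (l : ℝ) ≠ 0 := by positivity
    have hc0 : 0 ≤ 1 - (l : ℝ)⁻¹ := sub_nonneg.2 (inv_le_one_of_one_le₀ hl1)
    have hnc : ‖(1 - (l : ℂ)⁻¹)‖ = 1 - (l : ℝ)⁻¹ := by
      rw [← Complex.norm_of_nonneg hc0]
      push_cast
      rfl
    have hprod : ∀ η : MulChar E ℂ, ∑ x, η (u x) * ∏ k ∈ insert l S, notPow k (u x) =
        (1 - (l : ℂ)⁻¹) * ∑ x, η (u x) * ∏ k ∈ S, notPow k (u x) -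
        (l : ℂ)⁻¹ * ∑ j ∈ Finset.Ico 1 l, ∑ x, (η * χ ^ j) (u x) * ∏ k ∈ S, notPow k (u x) := by
      intro η
      rw [Finset.sum_comm, Finset.mul_sum, Finset.mul_sum, ← Finset.sum_sub_distrib]
      refine Finset.sum_congr rfl fun x _ => ?_
      rw [Finset.prod_insert hlS, ← mul_assoc, hmul, ← Finset.sum_mul]
      ring
    have hχj : ∀ j ∈ Finset.Ico 1 l, (χ ^ j) ^ l = 1 ∧ χ ^ j ≠ 1 := by
      intro j hj
      rw [Finset.mem_Ico] at hj
      refine ⟨by rw [← pow_mul, mul_comm, pow_mul, ← hχ, pow_orderOf_eq_one, one_pow], ?_⟩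
      exact pow_ne_one_of_lt_orderOf (by omega) (hχ ▸ hj.2)
    have hlcop : ∀ k ∈ S, l.Coprime k := fun k hk =>
      (Nat.coprime_primes hl (hS k (Finset.mem_insert_of_mem hk)).1).2 fun h => hlS (h ▸ hk)
    have hrest : ∀ (N : ℕ) (η : MulChar E ℂ), (∀ k ∈ insert l S, N.Coprime k) → η ^ N = 1 →
        ‖(l : ℂ)⁻¹ * ∑ j ∈ Finset.Ico 1 l, ∑ x, (η * χ ^ j) (u x) * ∏ k ∈ S, notPow k (u x)‖ ≤
          (1 - (l : ℝ)⁻¹) * (θ * 2 ^ S.card * B) := by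
      intro N η hN hη
      have hj : ∀ j ∈ Finset.Ico 1 l,
          ‖∑ x, (η * χ ^ j) (u x) * ∏ k ∈ S, notPow k (u x)‖ ≤ θ * 2 ^ S.card * B := by
        intro j hj
        obtain ⟨h1, h2⟩ := hχj j hj
        refine ih1 (N * l) _ (fun k hk => Nat.Coprime.mul_left
          (hN k (Finset.mem_insert_of_mem hk)) (hlcop k hk)) ?_ ?_
        · rw [mul_pow, pow_mul, hη, one_pow, mul_comm N l, pow_mul, h1, one_pow, one_mul]
        · intro h
          have h3 : (χ ^ j) ^ N = 1 := by
            have := congrArg (· ^ N) h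
            simpa [mul_pow, hη] using this
          have h4 := Nat.dvd_gcd (orderOf_dvd_of_pow_eq_one h3) (orderOf_dvd_of_pow_eq_one h1)
          rw [hN l (Finset.mem_insert_self _ _), Nat.dvd_one, orderOf_eq_one_iff] at h4
          exact h2 h4
      rw [norm_mul, norm_inv, Complex.norm_natCast]
      have := norm_sum_le_of_le _ hj
      rw [Finset.sum_const, Nat.card_Ico, nsmul_eq_mul, Nat.cast_sub hl.one_le, Nat.cast_one]
        at this
      calc _ ≤ (l : ℝ)⁻¹ * (((l : ℝ) - 1) * (θ * 2 ^ S.card * B)) := by gcongr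
        _ = _ := by field_simp
    rw [Finset.prod_insert hlS, Finset.prod_insert hlS, Finset.card_insert_of_notMem hlS, ← hθ]
    constructor
    · intro N η hN hη hη1
      rw [hprod]
      refine (norm_sub_le _ _).trans ?_
      have h1 := ih1 N η (fun k hk => hN k (Finset.mem_insert_of_mem hk)) hη hη1
      have h2 := hrest N η hN hη
      rw [norm_mul, hnc]
      have h3 := mul_le_mul_of_nonneg_left h1 hc0
      rw [pow_succ]
      linarith
    · rw [hprod]
      have h2 := hrest 1 1 (fun k _ => Nat.coprime_one_left k) (one_pow _)
      have h3 := mul_le_mul_of_nonneg_left ih2 hc0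
      rw [← hnc, ← norm_mul, hnc] at h3
      refine le_trans ?_ ((add_le_add h3 h2).trans_eq ?_)
      · refine le_trans (le_of_eq ?_) (norm_sub_le _ _)
        congr 1
        ring
      · rw [pow_succ]
        ring

open Classical in
/-- The elements `x` for which `L x` is nonzero and is not an `l`-th power for any prime
`l ∣ |E| - 1`. -/
def primSet {E : Type*} [Field E] [Fintype E] (L : E →+ E) : Finset E :=
  Finset.univ.filter fun x => L x ≠ 0 ∧
    ∀ l ∈ (Fintype.card E - 1).primeFactors, ¬ ∃ c : E, L x = c ^ l

theorem mem_primSet {E : Type*} [Field E] [Fintype E] {L : E →+ E} {x : E} :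
    x ∈ primSet L ↔ L x ≠ 0 ∧
      ∀ l ∈ (Fintype.card E - 1).primeFactors, ¬ ∃ c : E, L x = c ^ l := by
  simp [primSet]

theorem mem_primSet_congr {E : Type*} [Field E] [Fintype E] {L M : E →+ E} {x y : E}
    (h : L x = M y) : x ∈ primSet L ↔ y ∈ primSet M := by
  simp [mem_primSet, h]

theorem abs_card_primSet_sub_le {E : Type*} [Field E] [Fintype E] (L : E →+ E) :
    |((primSet L).card : ℝ) - (∏ l ∈ (Fintype.card E - 1).primeFactors, (1 - (l : ℝ)⁻¹)) *
      ((Fintype.card E : ℝ) - zeroCard L)| ≤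
    (∏ l ∈ (Fintype.card E - 1).primeFactors, (1 - (l : ℝ)⁻¹)) *
      (2 ^ (Fintype.card E - 1).primeFactors.card - 1) *
      (zeroCard L * √(Fintype.card E : ℝ)) := by
  classical
  set S := (Fintype.card E - 1).primeFactors
  have h := (norm_sum_prod_notPow_sub_le (fun x => L x)
    (fun χ hχ => norm_sum_mulChar_comp_le hχ L) S fun l hl =>
      ⟨Nat.prime_of_mem_primeFactors hl, Nat.dvd_of_mem_primeFactors hl⟩).2
  have h1 : ∑ x, (1 : MulChar E ℂ) (L x) = (Fintype.card E : ℂ) - zeroCard L := by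
    have : ∀ x, (1 : MulChar E ℂ) (L x) = 1 - if L x = 0 then 1 else 0 := by
      intro x
      split_ifs with hx
      · simp [hx, MulChar.map_zero]
      · rw [MulChar.one_apply (isUnit_iff_ne_zero.2 hx), sub_zero]
    simp [this, zeroCard, Fintype.card_subtype]
  have h2 : ∑ x, (1 : MulChar E ℂ) (L x) * ∏ l ∈ S, notPow l (L x) = (primSet L).card := by
    have : ∀ x, (1 : MulChar E ℂ) (L x) * ∏ l ∈ S, notPow l (L x) =
        if x ∈ primSet L then 1 else 0 := by
      intro x
      simp only [mem_primSet]
      by_cases hx : L x = 0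
      · simp [hx, MulChar.map_zero]
      rw [MulChar.one_apply (isUnit_iff_ne_zero.2 hx), one_mul]
      split_ifs with hp
      · exact Finset.prod_eq_one fun l hl => if_neg (hp.2 l hl)
      · simp only [ne_eq, hx, not_false_eq_true, true_and, not_forall, not_not] at hp
        obtain ⟨l, hl, hc⟩ := hp
        exact Finset.prod_eq_zero hl (if_pos hc)
    simp_rw [this]
    simp
  rw [h1, h2] at h
  rw [← Real.norm_eq_abs, ← Complex.norm_real]
  push_cast
  exact h

/-- The linearized `q`-associate of a polynomial, as an `F`-linear map. -/
def linAssoc (F : Type*) {E : Type*} [Field F] [Fintype F] [Field E] [Algebra F E] (f : F[X]) :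
    E →ₗ[F] E :=
  aeval (FiniteField.frobeniusAlgHom F E).toLinearMap f

section LinAssoc

variable {F E : Type*} [Field F] [Fintype F] [Field E] [Algebra F E]

theorem linAssoc_eq_sum (f : F[X]) (x : E) : linAssoc F f x =
    ∑ i ∈ Finset.range (f.natDegree + 1),
      algebraMap F E (f.coeff i) * x ^ Fintype.card F ^ i := by
  have hpow : ∀ i : ℕ, ((FiniteField.frobeniusAlgHom F E).toLinearMap ^ i) x =
      x ^ Fintype.card F ^ i := by
    intro i
    rw [Module.End.coe_pow, AlgHom.coe_toLinearMap, FiniteField.coe_frobeniusAlgHom,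
      pow_iterate]
  simp [linAssoc, aeval_eq_sum_range, LinearMap.sum_apply, hpow, Algebra.smul_def]

theorem Lf_eq_linAssoc (f : F[X]) (x : E) : Lf (Fintype.card F) f x = linAssoc F f x :=
  (linAssoc_eq_sum f x).symm

theorem linAssoc_mul (f g : F[X]) (x : E) :
    linAssoc F (f * g) x = linAssoc F f (linAssoc F g x) := by
  simp [linAssoc]

theorem zeroCard_linAssoc_le [Fintype E] {f : F[X]} (hf : f.Monic) :
    zeroCard (linAssoc F f : E →ₗ[F] E).toAddMonoidHom ≤ Fintype.card F ^ f.natDegree := by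
  classical
  set q := Fintype.card F
  have hq : 1 < q := Fintype.one_lt_card
  set P : E[X] := ∑ i ∈ Finset.range (f.natDegree + 1),
    C (algebraMap F E (f.coeff i)) * X ^ q ^ i with hP
  have hdeg : P.natDegree ≤ q ^ f.natDegree := by
    refine natDegree_sum_le_of_forall_le _ _ fun i hi => (natDegree_C_mul_X_pow_le _ _).trans ?_
    exact Nat.pow_le_pow_right hq.le (Nat.lt_succ_iff.1 (Finset.mem_range.1 hi))
  have hP0 : P ≠ 0 := by
    intro h
    have h1 : P.coeff (q ^ f.natDegree) = 1 := by
      rw [hP, finsetSum_coeff, Finset.sum_eq_single f.natDegree]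
      · simp [hf.coeff_natDegree]
      · intro i _ hi
        rw [coeff_C_mul_X_pow, if_neg]
        exact fun h => hi (Nat.pow_right_injective hq h).symm
      · simp
    rw [h, coeff_zero] at h1
    exact zero_ne_one h1
  have hsub : Finset.univ.filter (fun x : E => (linAssoc F f).toAddMonoidHom x = 0) ⊆
      P.roots.toFinset := by
    intro x hx
    rw [Finset.mem_filter] at hx
    rw [Multiset.mem_toFinset, mem_roots hP0, IsRoot, hP, eval_finsetSum]
    simpa [linAssoc_eq_sum] using hx.2
  rw [zeroCard, Nat.card_eq_fintype_card, Fintype.card_subtype]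
  exact ((Finset.card_le_card hsub).trans (Multiset.toFinset_card_le _)).trans
    ((card_roots' P).trans hdeg)

theorem linAssoc_X_pow_sub_one [Fintype E] (x : E) :
    linAssoc F (X ^ Module.finrank F E - 1) x = 0 := by
  rw [linAssoc, ← FiniteField.minpoly_frobeniusAlgHom, minpoly.aeval, LinearMap.zero_apply]

theorem exists_linAssoc_eq_eval_smul [Fintype E] {ζ : F} (hζ : ζ ^ Module.finrank F E = 1) :
    ∃ w : E, w ≠ 0 ∧ ∀ f : F[X], linAssoc F f w = f.eval ζ • w := by
  have hr : (minpoly F (FiniteField.frobeniusAlgHom F E).toLinearMap).IsRoot ζ := by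
    rw [FiniteField.minpoly_frobeniusAlgHom]
    simp [hζ]
  obtain ⟨w, hw⟩ := (Module.End.hasEigenvalue_of_isRoot hr).exists_hasEigenvector
  exact ⟨w, hw.2, fun f => Module.End.aeval_apply_of_hasEigenvector hw⟩

theorem notMem_range_linAssoc [Fintype E] {ζ : F} (hζ : ζ ^ Module.finrank F E = 1)
    (hn : (Module.finrank F E : F) ≠ 0) {w : E} (hw0 : w ≠ 0)
    (hw : ∀ f : F[X], linAssoc F f w = f.eval ζ • w) (y : E) :
    linAssoc F (X - C ζ) y ≠ w := by
  rintro hy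
  set n := Module.finrank F E
  have hζ0 : ζ ≠ 0 := by
    rintro rfl
    rw [zero_pow Module.finrank_pos.ne'] at hζ
    exact zero_ne_one hζ
  obtain ⟨g, hg⟩ : X - C ζ ∣ (X ^ n - 1 : F[X]) := by
    rw [dvd_iff_isRoot]
    simp [hζ]
  have h1 : linAssoc F g w = 0 := by
    rw [← hy, ← linAssoc_mul, mul_comm, ← hg, linAssoc_X_pow_sub_one]
  rw [hw, smul_eq_zero, or_iff_left hw0] at h1
  have h2 := congrArg (fun P => (derivative P).eval ζ) hg
  simp [derivative_X_pow, h1, hζ0, hn] at h2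

end LinAssoc

section Sieve

variable {F E : Type*} [Field F] [Fintype F] [Field E] [Fintype E] [Algebra F E]

open Classical in
/-- The part of `primSet (linAssoc F f)` inside the image of `linAssoc F (X - C ζ)`. -/
def primSetRange (E : Type*) [Field E] [Fintype E] [Algebra F E] (f : F[X]) (ζ : F) : Finset E :=
  (primSet (linAssoc F f : E →ₗ[F] E).toAddMonoidHom).filter
    fun x => ∃ y, linAssoc F (X - C ζ) y = x

theorem card_mul_primSetRange_le (f : F[X]) {ζ : F} (hζ : ζ ^ Module.finrank F E = 1) :
    Fintype.card F * (primSetRange E f ζ).card ≤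
      (primSet (linAssoc F (f * (X - C ζ)) : E →ₗ[F] E).toAddMonoidHom).card := by
  classical
  obtain ⟨w, hw0, hw⟩ := exists_linAssoc_eq_eval_smul (E := E) hζ
  have hw' : linAssoc F (X - C ζ) w = 0 := by simp [hw]
  have hex : ∀ x : E, ∃ y : E, x ∈ primSetRange E f ζ → linAssoc F (X - C ζ) y = x := by
    intro x
    by_cases hx : x ∈ primSetRange E f ζ
    · obtain ⟨y, hy⟩ := (Finset.mem_filter.1 hx).2
      exact ⟨y, fun _ => hy⟩
    · exact ⟨0, fun h => absurd h hx⟩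
  choose σ hσ using hex
  have hL : ∀ x ∈ primSetRange E f ζ, ∀ c : F,
      linAssoc F (X - C ζ) (σ x + c • w) = x := by
    intro x hx c
    rw [map_add, map_smul, hw', smul_zero, add_zero, hσ x hx]
  rw [← Finset.card_univ, ← Finset.card_product]
  refine Finset.card_le_card_of_injOn (fun c => σ c.2 + c.1 • w) ?_ ?_
  · rintro ⟨c, x⟩ hx
    have hx' : x ∈ primSetRange E f ζ := (Finset.mem_product.1 hx).2
    have h1 := (Finset.mem_filter.1 hx').1
    refine (mem_primSet_congr ?_).2 h1
    simp only [LinearMap.toAddMonoidHom_coe]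
    rw [linAssoc_mul, hL x hx']
  · rintro ⟨c, x⟩ hx ⟨d, y⟩ hy h
    have hx' : x ∈ primSetRange E f ζ := (Finset.mem_product.1 hx).2
    have hy' : y ∈ primSetRange E f ζ := (Finset.mem_product.1 hy).2
    simp only at h
    have hxy : x = y := by rw [← hL x hx' c, h, hL y hy' d]
    subst hxy
    rw [add_right_inj] at h
    rw [smul_left_injective F hw0 h]

theorem card_mul_primSetRange_le_of_isRoot {f : F[X]} {ζ : F}
    (hζ : ζ ^ Module.finrank F E = 1) (hn : (Module.finrank F E : F) ≠ 0) (hf : f.IsRoot ζ) :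
    Fintype.card F * (primSetRange E f ζ).card ≤
      (primSet (linAssoc F f : E →ₗ[F] E).toAddMonoidHom).card := by
  classical
  obtain ⟨w, hw0, hw⟩ := exists_linAssoc_eq_eval_smul (E := E) hζ
  rw [← Finset.card_univ, ← Finset.card_product]
  refine Finset.card_le_card_of_injOn (fun c => c.2 + c.1 • w) ?_ ?_
  · rintro ⟨c, x⟩ hx
    have hx' : x ∈ primSetRange E f ζ := (Finset.mem_product.1 hx).2
    refine (mem_primSet_congr ?_).2 (Finset.mem_filter.1 hx').1
    simp only [LinearMap.toAddMonoidHom_coe]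
    rw [map_add, map_smul, hw, hf, zero_smul, smul_zero, add_zero]
  · rintro ⟨c, x⟩ hx ⟨d, y⟩ hy h
    obtain ⟨x', hx'⟩ := (Finset.mem_filter.1 (Finset.mem_product.1 hx).2).2
    obtain ⟨y', hy'⟩ := (Finset.mem_filter.1 (Finset.mem_product.1 hy).2).2
    simp only at h hx' hy'
    have hcd : c = d := by
      by_contra hcd
      refine notMem_range_linAssoc hζ hn hw0 hw ((c - d)⁻¹ • (y' - x')) ?_
      rw [map_smul, map_sub, hx', hy', inv_smul_eq_iff₀ (sub_ne_zero.2 hcd), sub_smul]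
      linear_combination -h
    subst hcd
    rw [add_left_inj] at h
    rw [h]

theorem card_primSet_le_sum_of_Nf_eq_zero {f : F[X]}
    (hsplit : ((X : F[X]) ^ Module.finrank F E - 1).Splits) {Z : Finset F}
    (hZ : ∀ ζ, ζ ∈ Z ↔ ζ ^ Module.finrank F E = 1)
    (h0 : Nf (Fintype.card F) F E f (X ^ Module.finrank F E - 1) (Fintype.card E - 1) = 0) :
    (primSet (linAssoc F f : E →ₗ[F] E).toAddMonoidHom).card ≤
      ∑ ζ ∈ Z, (primSetRange E f ζ).card := by
  classical
  set n := Module.finrank F E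
  refine le_trans (Finset.card_le_card ?_) Finset.card_biUnion_le
  intro x hx
  rw [Nf, Nat.card_eq_zero, or_iff_left (not_infinite_iff_finite.2 inferInstance),
    isEmpty_subtype] at h0
  have hfree : IsFree (Fintype.card E - 1) (Lf (Fintype.card F) f x) := by
    rw [mem_primSet] at hx
    rw [Lf_eq_linAssoc]
    refine ⟨hx.1, fun d hd ⟨b, hb⟩ => ?_⟩
    by_contra hd1
    obtain ⟨l, hl, m, rfl⟩ := Nat.exists_prime_and_dvd hd1
    have hE : Fintype.card E - 1 ≠ 0 := (Nat.sub_pos_of_lt Fintype.one_lt_card).ne'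
    refine hx.2 l (Nat.mem_primeFactors.2 ⟨hl, (Dvd.intro _ rfl).trans hd, hE⟩) ⟨b ^ m, ?_⟩
    rw [← pow_mul, mul_comm m l]
    exact hb
  have hnot : ¬ IsPolyFree (Fintype.card F) ((X : F[X]) ^ n - 1) x :=
    fun h => h0 x ⟨h, hfree⟩
  simp only [IsPolyFree, not_forall] at hnot
  obtain ⟨h, hm, hd, ⟨b, hb⟩, h1⟩ := hnot
  have hne : ((X : F[X]) ^ n - 1) ≠ 0 := X_pow_sub_C_ne_zero Module.finrank_pos 1
  obtain ⟨ζ, hζ⟩ := (hsplit.of_dvd hne hd).exists_eval_eq_zero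
    fun hdeg => h1 (hm.degree_le_zero_iff_eq_one.1 hdeg.le)
  have hζn : ζ ^ n = 1 := by
    have := eval_eq_zero_of_dvd_of_eval_eq_zero hd hζ
    simpa [sub_eq_zero] using this
  obtain ⟨g, rfl⟩ := dvd_iff_isRoot.2 hζ
  refine Finset.mem_biUnion.2 ⟨ζ, (hZ ζ).2 hζn, Finset.mem_filter.2 ⟨hx, linAssoc F g b, ?_⟩⟩
  rw [← linAssoc_mul, ← hb, Lf_eq_linAssoc]

end Sieve


theorem Wnat_eq_two_pow {m : ℕ} (hm : m ≠ 0) : Wnat m = 2 ^ m.primeFactors.card := by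
  classical
  have h1 : Wnat m = (m.divisors.filter Squarefree).card := by
    refine Nat.subtype_card _ fun d => ?_
    simp [hm]
  have h2 := Nat.sum_divisors_filter_squarefree hm (f := fun _ => 1)
  rw [Finset.sum_const, Finset.sum_const, Finset.card_powerset, smul_eq_mul, mul_one, smul_eq_mul,
    mul_one] at h2
  rw [h1, h2, Nat.factors_eq]
  rfl

/-- The sieve inequality when `n` is divisible by the characteristic. -/
theorem sieve_contradiction_of_dvd {q s m W R θ A : ℝ} (hq : 0 < q) (hsq : s ≤ q)
    (hs : 0 ≤ s) (hθ : 0 < θ) (hW : 1 ≤ W) (hR : 1 < R) (hm : q * (s + 1) ≤ (q - s) * m)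
    (hb : m * W * q ^ 2 ≤ R)
    (hlow : θ * (R ^ 2 - q ^ 2 - (W - 1) * q ^ 2 * R) ≤ A)
    (hup : q * A ≤ s * (θ * (R ^ 2 + (W - 1) * q ^ 3 * R))) : False := by
  have h1 : θ * (q * (R ^ 2 - q ^ 2 - (W - 1) * q ^ 2 * R)) ≤
      θ * (s * (R ^ 2 + (W - 1) * q ^ 3 * R)) := by nlinarith
  have h2 := le_of_mul_le_mul_left h1 hθ
  have h3 : (q - s) * (m * W * q ^ 2) * R ≤ (q - s) * R * R := by gcongr
  have h4 : q * (s + 1) * (W * q ^ 2 * R) ≤ (q - s) * m * (W * q ^ 2 * R) := by gcongr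
  have h5 : 0 < q ^ 3 * (R - 1) := mul_pos (by positivity) (by linarith)
  have h6 : 0 ≤ q ^ 3 * s * R := by positivity
  nlinarith

/-- The sieve inequality when `n` is prime to the characteristic. -/
theorem sieve_contradiction_of_coprime {q s m W R θ A : ℝ} (hq2 : 2 ≤ q) (hsq : s ≤ q)
    (hs : 1 ≤ s) (hθ : 0 < θ) (hW : 1 ≤ W) (hR : 1 < R) (hm : s * (q - 1) ≤ (q - s) * m)
    (hb : m * W * q ^ 2 ≤ R)
    (hlow : θ * (R ^ 2 - q ^ 2 - (W - 1) * q ^ 2 * R) ≤ A)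
    (hup : q * A ≤ (s - 2) * (θ * (R ^ 2 + (W - 1) * q ^ 3 * R)) + 2 * A) : False := by
  have h0 := mul_le_mul_of_nonneg_left hlow (sub_nonneg.2 hq2)
  have h1 : θ * ((q - 2) * (R ^ 2 - q ^ 2 - (W - 1) * q ^ 2 * R)) ≤
      θ * ((s - 2) * (R ^ 2 + (W - 1) * q ^ 3 * R)) := by linarith
  have h2 := le_of_mul_le_mul_left h1 hθ
  have h3 : (q - s) * (m * W * q ^ 2) * R ≤ (q - s) * R * R := by gcongr
  have h4 : s * (q - 1) * (W * q ^ 2 * R) ≤ (q - s) * m * (W * q ^ 2 * R) := by gcongr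
  have h5 : 0 ≤ (W - 1) * (q ^ 2 * R) * (q - s + 2) :=
    mul_nonneg (mul_nonneg (by linarith) (by positivity)) (by linarith)
  have h6 : 0 ≤ (s - 1) * ((q - 1) * q ^ 2 * R) :=
    mul_nonneg (by linarith) (mul_nonneg (mul_nonneg (by linarith) (by positivity)) (by linarith))
  have h7 : 0 ≤ (q - 1) * q ^ 2 * (R - 1) :=
    mul_nonneg (mul_nonneg (by linarith) (by positivity)) (by linarith)
  have h8 : 0 < q ^ 2 := by positivity
  nlinarith

theorem mul_add_one_le_sub_mul_min {q s n : ℝ} (hsq : s + 1 ≤ q)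
    (hs1 : 1 ≤ s) (hn : 2 * s ≤ n) : q * (s + 1) ≤ (q - s) * min (q ^ 2) (n ^ 2) := by
  have h0 : 0 ≤ q - s := by linarith
  rcases min_cases (q ^ 2) (n ^ 2) with ⟨h, -⟩ | ⟨h, -⟩ <;> rw [h]
  · nlinarith [mul_nonneg (by linarith : 0 ≤ q - s - 1) (sq_nonneg q)]
  · have h1 : (s + 1) ^ 2 ≤ n ^ 2 := by gcongr; linarith
    have h2 := mul_le_mul_of_nonneg_left h1 h0
    have h3 : 0 ≤ s * (q - s - 1) * (s + 1) := by
      have : 0 ≤ q - s - 1 := by linarith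
      positivity
    nlinarith

theorem mul_sub_one_le_sub_mul_min {q s n : ℝ} (hs : 1 ≤ s) (hsq : s + 1 ≤ q) (hn : s ≤ n) :
    s * (q - 1) ≤ (q - s) * min (q ^ 2) (n ^ 2) := by
  have h1 : s ^ 2 ≤ min (q ^ 2) (n ^ 2) := by
    refine le_min ?_ ?_ <;> gcongr
    linarith
  have h2 := mul_le_mul_of_nonneg_left h1 (by linarith : 0 ≤ q - s)
  have h3 : 0 ≤ s * ((s - 1) * (q - s - 1)) :=
    mul_nonneg (by linarith) (mul_nonneg (by linarith) (by linarith))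
  nlinarith

theorem X_pow_sub_one_splits_of_dvd {F : Type*} [Field F] [Fintype F] {k : ℕ}
    (hk : k ∣ Fintype.card F - 1) : (X ^ k - 1 : F[X]).Splits := by
  have h1 : (X ^ Fintype.card F - X : F[X]) = (X ^ (Fintype.card F - 1) - 1) * X := by
    rw [sub_mul, one_mul, ← pow_succ, Nat.sub_add_cancel Fintype.card_pos]
  have h2 : (X ^ k - 1 : F[X]) ∣ X ^ Fintype.card F - X :=
    h1 ▸ (dvd_pow_sub_one_of_dvd hk).mul_right X
  refine Splits.of_dvd ?_ (FiniteField.X_pow_card_sub_X_ne_zero F Fintype.one_lt_card) h2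
  rw [splits_iff_card_roots, FiniteField.roots_X_pow_card_sub_X,
    FiniteField.X_pow_card_sub_X_natDegree_eq F Fintype.one_lt_card]
  rfl

/-- Let `p` be a prime, `q` a power of `p`, and `n = p^α·n₀ ≥ 5` with `p ∤ n₀` and
`n₀ ∣ q - 1`.  If `q^{n/2-2} ≥ min(q², n²)·W(q^n - 1)`, then `N_f(x^n-1, q^n-1) > 0`
for every monic factor `f` of degree 2 of `x^n - 1` in `F_q[x]`. -/
theorem Nf_pos_case_linear (p : ℕ) (hp : p.Prime) (q e : ℕ) (he : 0 < e) (hq : q = p ^ e)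
    (α n₀ n : ℕ) (hn : n = p ^ α * n₀) (hn5 : 5 ≤ n) (hpn : ¬ p ∣ n₀) (hdvd : n₀ ∣ q - 1)
    (F E : Type*) [Field F] [Fintype F] [Field E] [Fintype E] [Algebra F E]
    (hF : Fintype.card F = q) (hE : Fintype.card E = q ^ n)
    (hbound : min ((q : ℝ) ^ 2) ((n : ℝ) ^ 2) * (Wnat (q ^ n - 1) : ℝ)
      ≤ (q : ℝ) ^ ((n : ℝ) / 2 - 2)) :
    ∀ f : Polynomial F, f.Monic → f.natDegree = 2 → f ∣ (X : Polynomial F) ^ n - 1 →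
      0 < Nf q F E f ((X : Polynomial F) ^ n - 1) (q ^ n - 1) := by
  intro f hfm hf2 hfd
  classical
  subst hq
  have := Fact.mk hp
  have hchar : CharP F p := charP_of_card_eq_prime_pow hF
  set q := p ^ e
  have hq1 : 1 < q := hF ▸ Fintype.one_lt_card
  have hfin : Module.finrank F E = n := by
    have h := Module.card_eq_pow_finrank (K := F) (V := E)
    rw [hE, hF] at h
    exact (Nat.pow_right_injective hq1 h).symm
  have hn₀ : 0 < n₀ := Nat.pos_of_ne_zero fun h => hpn (h ▸ dvd_zero p)
  have hn₀q : n₀ ≤ q - 1 := Nat.le_of_dvd (Nat.sub_pos_of_lt hq1) hdvd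
  have hsplit₀ : (X ^ n₀ - 1 : F[X]).Splits := X_pow_sub_one_splits_of_dvd (hF.symm ▸ hdvd)
  have hpow : (X ^ n - 1 : F[X]) = (X ^ n₀ - 1) ^ p ^ α := by
    rw [sub_pow_char_pow, one_pow, ← pow_mul, hn, mul_comm]
  have hsplit : (X ^ n - 1 : F[X]).Splits := hpow ▸ hsplit₀.pow _
  set Z : Finset F := Finset.univ.filter fun ζ => ζ ^ n = 1 with hZdef
  have hZ : ∀ ζ, ζ ∈ Z ↔ ζ ^ n = 1 := by simp [hZdef]
  have hZcard : Z.card ≤ n₀ := by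
    refine le_trans (Finset.card_le_card (t := (nthRoots n₀ (1 : F)).toFinset) ?_)
      ((Multiset.toFinset_card_le _).trans (card_nthRoots n₀ 1))
    intro ζ hζ
    rw [Multiset.mem_toFinset, mem_nthRoots hn₀]
    have h1 := congrArg (eval ζ) hpow
    simp only [eval_sub, eval_pow, eval_X, eval_one, (hZ ζ).1 hζ, sub_self] at h1
    exact sub_eq_zero.1 (pow_eq_zero_iff (pow_pos hp.pos α).ne' |>.1 h1.symm)
  have hZ1 : 1 ≤ Z.card := Finset.card_pos.2 ⟨1, (hZ 1).2 (one_pow n)⟩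
  rw [Nat.pos_iff_ne_zero]
  intro h0
  have hsum := card_primSet_le_sum_of_Nf_eq_zero (F := F) (E := E) (f := f) (Z := Z)
    (by rw [hfin]; exact hsplit) (by rw [hfin]; exact hZ) (by rw [hfin, hF, hE]; exact h0)
  set A := (primSet (linAssoc F f : E →ₗ[F] E).toAddMonoidHom).card
  set S := (Fintype.card E - 1).primeFactors with hS
  set θ : ℝ := ∏ l ∈ S, (1 - (l : ℝ)⁻¹)
  have hθ : 0 < θ := Finset.prod_pos fun l hl => sub_pos.2 <| inv_lt_one_of_one_lt₀ <| by
    exact_mod_cast (Nat.prime_of_mem_primeFactors hl).one_lt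
  set W : ℝ := 2 ^ S.card
  have hW : 1 ≤ W := one_le_pow₀ one_le_two
  have hWnat : (Wnat (q ^ n - 1) : ℝ) = W := by
    rw [← hE, Wnat_eq_two_pow (Nat.sub_pos_of_lt Fintype.one_lt_card).ne']
    simp [W, hS]
  have hq2 : (2 : ℝ) ≤ q := by exact_mod_cast hq1
  have hq0 : (0 : ℝ) < q := by linarith
  set R : ℝ := √(Fintype.card E : ℝ)
  have hR2 : (Fintype.card E : ℝ) = R ^ 2 := (Real.sq_sqrt (Nat.cast_nonneg _)).symm
  have habs : ∀ L : E →+ E, |((primSet L).card : ℝ) - θ * (R ^ 2 - zeroCard L)| ≤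
      θ * (W - 1) * (zeroCard L * R) := by
    intro L
    rw [← hR2]
    exact abs_card_primSet_sub_le L
  have hR1 : 1 < R := Real.lt_sqrt_of_sq_lt (by
    rw [one_pow]
    exact_mod_cast (Fintype.one_lt_card : 1 < Fintype.card E))
  have hRpow : (q : ℝ) ^ ((n : ℝ) / 2 - 2) = R / q ^ 2 := by
    rw [Real.rpow_sub hq0, Real.rpow_ofNat]
    congr 1
    simp only [R]
    rw [eq_comm, Real.sqrt_eq_rpow, hE, Nat.cast_pow, ← Real.rpow_natCast, ← Real.rpow_mul hq0.le]
    ring_nf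
  rw [hWnat, hRpow, le_div_iff₀ (by positivity)] at hbound
  have hlow : θ * (R ^ 2 - q ^ 2 - (W - 1) * q ^ 2 * R) ≤ A := by
    have h1 := (abs_le.1 (habs (linAssoc F f : E →ₗ[F] E).toAddMonoidHom)).1
    have h2 : (zeroCard (linAssoc F f : E →ₗ[F] E).toAddMonoidHom : ℝ) ≤ q ^ 2 := by
      have := zeroCard_linAssoc_le (E := E) hfm
      rw [hF, hf2] at this
      exact_mod_cast this
    have h3 : θ * ((1 + (W - 1) * R) *
        (zeroCard (linAssoc F f : E →ₗ[F] E).toAddMonoidHom : ℝ)) ≤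
        θ * ((1 + (W - 1) * R) * q ^ 2) := by
      have : 0 ≤ 1 + (W - 1) * R := by nlinarith
      gcongr
    linarith
  have hup : ∀ ζ ∈ Z, (q : ℝ) * (primSetRange E f ζ).card ≤
      θ * (R ^ 2 + (W - 1) * q ^ 3 * R) := by
    intro ζ hζ
    have h0 := card_mul_primSetRange_le (E := E) f (by rw [hfin]; exact (hZ ζ).1 hζ)
    rw [hF] at h0
    set L := (linAssoc F (f * (X - C ζ)) : E →ₗ[F] E).toAddMonoidHom
    have h0' : (q : ℝ) * (primSetRange E f ζ).card ≤ (primSet L).card := by exact_mod_cast h0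
    have h1 := (abs_le.1 (habs L)).2
    have h2 : (zeroCard L : ℝ) ≤ q ^ 3 := by
      have := zeroCard_linAssoc_le (E := E) (hfm.mul (monic_X_sub_C ζ))
      rw [hfm.natDegree_mul (monic_X_sub_C ζ), natDegree_X_sub_C, hF, hf2] at this
      exact_mod_cast this
    have h3 : θ * (((W - 1) * R) * (zeroCard L : ℝ)) ≤ θ * (((W - 1) * R) * q ^ 3) := by
      have : 0 ≤ (W - 1) * R := by nlinarith
      gcongr
    have h4 : 0 ≤ θ * (zeroCard L : ℝ) := by positivity
    linarith
  have hsumR : (A : ℝ) ≤ ∑ ζ ∈ Z, ((primSetRange E f ζ).card : ℝ) := by exact_mod_cast hsum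
  have hs1 : (1 : ℝ) ≤ Z.card := by exact_mod_cast hZ1
  have hsq : (Z.card : ℝ) + 1 ≤ q := by
    have : Z.card + 1 ≤ q := by omega
    exact_mod_cast this
  have hsumR' := mul_le_mul_of_nonneg_left hsumR hq0.le
  rcases Nat.eq_zero_or_pos α with hα | hα
  · have hnn : n = n₀ := by rw [hn, hα, pow_zero, one_mul]
    have hnF : (n : F) ≠ 0 := by
      rw [Ne, CharP.cast_eq_zero_iff F p, hnn]
      exact hpn
    have hroots : f.roots.toFinset.card = 2 := by
      have hsep : (X ^ n - 1 : F[X]).Separable := X_pow_sub_one_separable_iff.2 hnF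
      rw [Multiset.toFinset_card_of_nodup (nodup_roots (hsep.of_dvd hfd)), ← hf2]
      exact (hsplit.of_dvd (X_pow_sub_C_ne_zero (by omega) 1) hfd).natDegree_eq_card_roots.symm
    have hsub : f.roots.toFinset ⊆ Z := by
      intro ζ hζ
      rw [Multiset.mem_toFinset, mem_roots hfm.ne_zero] at hζ
      have := eval_eq_zero_of_dvd_of_eval_eq_zero hfd hζ
      rw [hZ]
      simpa [sub_eq_zero] using this
    refine sieve_contradiction_of_coprime hq2 (by linarith) hs1 hθ hW hR1
      (mul_sub_one_le_sub_mul_min hs1 hsq (n := n) ?_) hbound hlow (hsumR'.trans ?_)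
    · exact_mod_cast hnn ▸ hZcard
    rw [Finset.mul_sum, ← Finset.sum_sdiff hsub]
    refine add_le_add ?_ ?_
    · refine (Finset.sum_le_card_nsmul _ _ _ fun ζ hζ =>
        hup ζ (Finset.mem_sdiff.1 hζ).1).trans_eq ?_
      rw [nsmul_eq_mul, Finset.card_sdiff_of_subset hsub, hroots,
        Nat.cast_sub (hroots ▸ Finset.card_le_card hsub), Nat.cast_ofNat]
    · refine (Finset.sum_le_card_nsmul _ _ (A : ℝ) fun ζ hζ => ?_).trans_eq ?_
      · have h := card_mul_primSetRange_le_of_isRoot (E := E) (f := f) (ζ := ζ)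
          (by rw [hfin]; exact (hZ ζ).1 (hsub hζ)) (by rw [hfin]; exact hnF)
          (isRoot_of_mem_roots (Multiset.mem_toFinset.1 hζ))
        rw [hF] at h
        exact_mod_cast h
      · rw [hroots, nsmul_eq_mul, Nat.cast_ofNat]
  · have h2n : 2 * Z.card ≤ n := by
      rw [hn]
      exact Nat.mul_le_mul (hp.two_le.trans (Nat.le_self_pow hα.ne' p)) hZcard
    refine sieve_contradiction_of_dvd hq0 (by linarith) (by linarith) hθ hW hR1
      (mul_add_one_le_sub_mul_min hsq hs1 (n := n) (by exact_mod_cast h2n)) hbound hlow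
      (hsumR'.trans ?_)
    rw [Finset.mul_sum, ← nsmul_eq_mul]
    exact Finset.sum_le_card_nsmul _ _ _ hup

end
end
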